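/- For every α ∈ (0,1) and every f ∈ 𝒱₁, the function ℛ_α(f) again belongs to 𝒱₁; that is, ℛ_α(f) is an even continuous function with finite weighted norm sup_x ρ(x)|ℛ_α(f)(x)|, it satisfies ℛ_α(f)(0)=1, ℛ_α(f) is nonnegative and non-increasing on [0,∞), x ↦ ℛ_α(f)(√x) is convex on [0,∞), ℛ_α(f)(x) ≥ max(0,1−x²) for all x, and the left derivative of ℛ_α(f) at 1/2 satisfies (ℛ_α(f))'₋(1/2) ≤ −η. -/

import Mathlib

open Real MeasureTheory Set Filter BoundedContinuousFunction

noncomputable section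

namespace GSQGplane

/-- The constant `c_{1,α} = 2^{2α-1} Γ(1/2+α) / (√π Γ(1-α))`. -/
def C1 (α : ℝ) : ℝ :=
  (2:ℝ) ^ (2*α - 1) * Real.Gamma (1/2 + α) / (Real.sqrt π * Real.Gamma (1 - α))

/-- The constant `η = 2 (3/(2(3-2α)(5-2α)(1+4^α)))^{1/min(α,1-α)}`. -/
def etaC (α : ℝ) : ℝ :=
  2 * (3 / (2*(3 - 2*α)*(5 - 2*α)*(1 + (4:ℝ) ^ α))) ^ (1 / min α (1 - α))

/-- The weight `ρ(x) = (1+|x|)^{-α}`. -/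
def rho (α : ℝ) (x : ℝ) : ℝ := (1 + |x|) ^ (-α)

/-- The invariant set `𝒱₁`: even continuous functions with finite weighted sup-norm,
`f(0)=1`, nonnegative and non-increasing on `[0,∞)`, `x ↦ f(√x)` convex,
`f ≥ max(0,1-x²)`, and left derivative at `1/2` at most `-η`. -/
def V1 (α : ℝ) (f : ℝ → ℝ) : Prop :=
  Continuous f ∧ (∀ x : ℝ, f (-x) = f x) ∧ (∃ M : ℝ, ∀ x : ℝ, rho α x * |f x| ≤ M) ∧
  f 0 = 1 ∧ (∀ x ∈ Ici (0:ℝ), 0 ≤ f x) ∧ AntitoneOn f (Ici (0:ℝ)) ∧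
  ConvexOn ℝ (Ici (0:ℝ)) (fun x => f (Real.sqrt x)) ∧
  (∀ x : ℝ, max 0 (1 - x^2) ≤ f x) ∧
  (∃ d : ℝ, HasDerivWithinAt f d (Iio (1/2 : ℝ)) (1/2 : ℝ) ∧ d ≤ -(etaC α))

/-- The normalization functional `c(f)`. -/
def cV (α : ℝ) (f : ℝ → ℝ) : ℝ :=
  (2*α*(1+2*α)/3) * C1 α * ∫ ξ in Ioi (0:ℝ), (1 - f ξ) * ξ ^ (-1 - 2*α)

/-- The functional `b(f) = 2 c_{1,α} ∫₀^∞ f(ξ) ξ^{1-2α} dξ`. -/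
def bV (α : ℝ) (f : ℝ → ℝ) : ℝ :=
  2 * C1 α * ∫ ξ in Ioi (0:ℝ), f ξ * ξ ^ (1 - 2*α)

/-- The linear operator `𝒯_α(f)`, defined for `x > 0`, set to `0` at `x = 0`,
and extended evenly to `ℝ` (via `|x|`). -/
def TV (α : ℝ) (f : ℝ → ℝ) (x : ℝ) : ℝ :=
  if x = 0 then 0
  else if α = 1/2 then
    C1 α * ∫ ξ in Ioi (0:ℝ), f ξ * ((ξ / |x|) * Real.log ((|x| + ξ) / |(|x| - ξ)|) - 2)
  else
    (C1 α / (1 - 2*α)) * ∫ ξ in Ioi (0:ℝ),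
      f ξ * ((ξ / |x|) * ((|x| + ξ) ^ (1 - 2*α) - |(|x| - ξ)| ^ (1 - 2*α))
        - 2*(1 - 2*α) * ξ ^ (1 - 2*α))

/-- The nonlinear map `ℛ_α(f)(x) = max(0, 1 + 𝒯_α(f)(x)/c(f))`. -/
def RV (α : ℝ) (f : ℝ → ℝ) (x : ℝ) : ℝ := max 0 (1 + TV α f x / cV α f)

/-- The even primitive of `|y|^p / y`, with value `0` at `y = ±1`; it is `log |y|` for `p = 0`. -/
def psi (p y : ℝ) : ℝ := if p = 0 then Real.log y else (|y| ^ p - 1) / p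

lemma mul_psi (p y : ℝ) : p * psi p y = |y| ^ p - 1 := by
  unfold psi
  split_ifs with h
  · simp [h]
  · field_simp

lemma psi_neg (p y : ℝ) : psi p (-y) = psi p y := by
  simp [psi]

lemma hasDerivAt_abs_rpow (p : ℝ) {y : ℝ} (hy : y ≠ 0) :
    HasDerivAt (fun y : ℝ => |y| ^ p) (p * |y| ^ p / y) y := by
  have h := (hasDerivAt_abs hy).rpow_const (p := p) (Or.inl (abs_ne_zero.mpr hy))
  convert h using 1
  rw [Real.rpow_sub_one (abs_ne_zero.mpr hy)]
  rcases hy.lt_or_gt with h | h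
  · simp [h, abs_of_neg]
    field_simp
  · simp [h, abs_of_pos]
    field_simp

lemma hasDerivAt_psi (p : ℝ) {y : ℝ} (hy : y ≠ 0) :
    HasDerivAt (psi p) (|y| ^ p / y) y := by
  by_cases h : p = 0
  · have : psi p = Real.log := by ext z; simp [psi, h]
    rw [this, h]
    simpa using Real.hasDerivAt_log hy
  · have : psi p = fun y => (|y| ^ p - 1) / p := by ext z; simp [psi, h]
    rw [this]
    refine (((hasDerivAt_abs_rpow p hy).sub_const 1).div_const p).congr_deriv ?_
    field_simp

lemma continuous_mul_abs_rpow {p : ℝ} (hp : -1 < p) :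
    Continuous fun y : ℝ => y * |y| ^ p := by
  rw [continuous_iff_continuousAt]
  intro y
  by_cases hy : y = 0
  · subst hy
    have h0 : Tendsto (fun y : ℝ => |y| ^ (p + 1)) (nhds 0) (nhds 0) := by
      have : Continuous fun y : ℝ => |y| ^ (p + 1) :=
        continuous_abs.rpow_const (fun _ => Or.inr (by linarith))
      simpa [Real.zero_rpow (show p + 1 ≠ 0 by linarith)] using this.tendsto 0
    have : Tendsto (fun y : ℝ => y * |y| ^ p) (nhds 0) (nhds 0) := by
      refine squeeze_zero_norm (fun z => ?_) h0
      by_cases hz : z = 0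
      · simp [hz, Real.zero_rpow (show p + 1 ≠ 0 by linarith)]
      · rw [Real.norm_eq_abs, abs_mul, abs_of_nonneg (Real.rpow_nonneg (abs_nonneg z) p),
          Real.rpow_add_one (abs_ne_zero.mpr hz), mul_comm]
    simpa [ContinuousAt] using this
  · exact continuousAt_id.mul (hasDerivAt_abs_rpow p hy).continuousAt

lemma continuous_mul_psi {p : ℝ} (hp : -1 < p) : Continuous fun y : ℝ => y * psi p y := by
  by_cases h : p = 0
  · simpa [psi, h] using Real.continuous_mul_log
  · have : (fun y : ℝ => y * psi p y) = fun y => (y * |y| ^ p - y) / p := by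
      ext y
      simp only [psi, h, if_false]
      ring
    rw [this]
    exact ((continuous_mul_abs_rpow hp).sub continuous_id).div_const p

/-- Midpoint convexity of a negative power. -/
lemma two_mul_rpow_le_add {r x y : ℝ} (hr : r ≤ 0) (hy : |y| < x) :
    2 * x ^ r ≤ (x + y) ^ r + (x - y) ^ r := by
  have h1 := abs_lt.mp hy
  have ha : 0 < x + y := by linarith
  have hb : 0 < x - y := by linarith
  have hx : 0 < x := by linarith
  have hA := Real.rpow_nonneg ha.le (r / 2)
  have hB := Real.rpow_nonneg hb.le (r / 2)
  have e : ∀ z : ℝ, 0 < z → z ^ r = z ^ (r / 2) * z ^ (r / 2) := fun z hz => by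
    rw [← Real.rpow_add hz]; congr 1; ring
  have h : x ^ r ≤ (x + y) ^ (r / 2) * (x - y) ^ (r / 2) := by
    rw [← Real.mul_rpow ha.le hb.le, e x hx, ← Real.mul_rpow hx.le hx.le]
    exact Real.rpow_le_rpow_of_nonpos (by positivity) (by nlinarith [sq_nonneg y]) (by linarith)
  rw [e _ ha, e _ hb]
  nlinarith [sq_nonneg ((x + y) ^ (r / 2) - (x - y) ^ (r / 2))]

lemma psi_mono {p y z : ℝ} (hy : 0 < y) (hyz : y ≤ z) : psi p y ≤ psi p z := by
  have : MonotoneOn (psi p) (Ioi 0) := by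
    refine monotoneOn_of_deriv_nonneg (convex_Ioi 0)
      (fun y hy => (hasDerivAt_psi p (ne_of_gt hy)).continuousAt.continuousWithinAt) ?_ ?_
    · intro y hy
      rw [interior_Ioi] at hy
      exact (hasDerivAt_psi p (ne_of_gt hy)).differentiableAt.differentiableWithinAt
    · intro y hy
      rw [interior_Ioi] at hy
      rw [(hasDerivAt_psi p (ne_of_gt hy)).deriv]
      have : (0:ℝ) < y := hy
      positivity
  exact this hy (lt_of_lt_of_le hy hyz) hyz

lemma psi_mul_sub {p t y z : ℝ} (ht : 0 < t) (hy : y ≠ 0) (hz : z ≠ 0) :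
    psi p (t * y) - psi p (t * z) = t ^ p * (psi p y - psi p z) := by
  unfold psi
  split_ifs with h
  · simp [h, Real.log_mul ht.ne' hy, Real.log_mul ht.ne' hz]
  · rw [abs_mul, abs_mul, abs_of_pos ht, Real.mul_rpow ht.le (abs_nonneg _),
      Real.mul_rpow ht.le (abs_nonneg _)]
    ring

/-- Contribution of the endpoint `ξ = s` (`s = ±1`) to `∫₀¹ (ξ - ξ³) (ψ(x+ξ) - ψ(x-ξ)) dξ`. -/
def tentEnd (p s x : ℝ) : ℝ :=
  (1 - x ^ 2) ^ 2 / 4 * psi p (x + s)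
    - (-(x + s) ^ 4 / (p + 4) + 4 * x * (x + s) ^ 3 / (p + 3)
        + (2 - 6 * x ^ 2) * (x + s) ^ 2 / (p + 2)
        + (4 * x ^ 3 - 4 * x) * (x + s) / (p + 1)) / 4 * |x + s| ^ p

/-- First derivative of `tentEnd`. -/
def tentEnd₁ (p s x : ℝ) : ℝ :=
  (x ^ 3 - x) * psi p (x + s)
    - ((x + s) ^ 3 / (p + 3) - 3 * x * (x + s) ^ 2 / (p + 2)
        + (3 * x ^ 2 - 1) * (x + s) / (p + 1)) * |x + s| ^ p

/-- Second derivative of `tentEnd`. -/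
def tentEnd₂ (p s x : ℝ) : ℝ :=
  (3 * x ^ 2 - 1) * psi p (x + s)
    + (3 * (x + s) ^ 2 / (p + 2) - 6 * x * (x + s) / (p + 1)) * |x + s| ^ p

/-- Third derivative of `tentEnd`. -/
def tentEnd₃ (p s x : ℝ) : ℝ :=
  6 * x * psi p (x + s)
    + ((3 * x ^ 2 - 1) / (x + s) + 3 * (p - 1) / (p + 1) * (x + s) - 6 * x) * |x + s| ^ p

/-- Fourth derivative of `tentEnd`. -/
def tentEnd₄ (p s x : ℝ) : ℝ :=
  6 * psi p (x + s) + (-6 * s / (x + s) + 2 * (p - 1) / (x + s) ^ 2) * |x + s| ^ p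

lemma hasDerivAt_of_eq_quartic {f : ℝ → ℝ} (c₀ c₁ c₂ c₃ c₄ x : ℝ)
    (hf : ∀ x, f x = c₀ + c₁ * x + c₂ * x ^ 2 + c₃ * x ^ 3 + c₄ * x ^ 4) :
    HasDerivAt f (c₁ + 2 * c₂ * x + 3 * c₃ * x ^ 2 + 4 * c₄ * x ^ 3) x := by
  have h := (((((hasDerivAt_id x).const_mul c₁).const_add c₀).add
    ((hasDerivAt_pow 2 x).const_mul c₂)).add ((hasDerivAt_pow 3 x).const_mul c₃)).add
    ((hasDerivAt_pow 4 x).const_mul c₄)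
  rw [show f = _ from funext hf]
  refine h.congr_deriv ?_
  norm_num
  ring

section Derivatives

variable {p s x : ℝ}

lemma hasDerivAt_mul_psi_add_mul_rpow {A B : ℝ → ℝ} {A' B' : ℝ} (hx : x + s ≠ 0)
    (hA : HasDerivAt A A' x) (hB : HasDerivAt B B' x) :
    HasDerivAt (fun x => A x * psi p (x + s) + B x * |x + s| ^ p)
      (A' * psi p (x + s) + (B' + (A x + p * B x) / (x + s)) * |x + s| ^ p) x := by
  have h := (hA.mul ((hasDerivAt_psi p hx).comp_add_const x s)).add
    (hB.mul ((hasDerivAt_abs_rpow p hx).comp_add_const x s))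
  refine h.congr_deriv ?_
  field_simp
  ring

lemma hasDerivAt_tentEnd (hp : -1 < p) (hs : s = 1 ∨ s = -1) (hx : x + s ≠ 0) :
    HasDerivAt (tentEnd p s) (tentEnd₁ p s x) x := by
  have h1 : p + 1 ≠ 0 := by linarith
  have h2 : p + 2 ≠ 0 := by linarith
  have h3 : p + 3 ≠ 0 := by linarith
  have h4 : p + 4 ≠ 0 := by linarith
  have hA : HasDerivAt (fun x : ℝ => (1 - x ^ 2) ^ 2 / 4) _ x :=
    hasDerivAt_of_eq_quartic (1/4) 0 (-1/2) 0 (1/4) x (fun x => by ring)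
  have hB : HasDerivAt (fun x => -((-(x + s) ^ 4 / (p + 4) + 4 * x * (x + s) ^ 3 / (p + 3)
        + (2 - 6 * x ^ 2) * (x + s) ^ 2 / (p + 2)
        + (4 * x ^ 3 - 4 * x) * (x + s) / (p + 1)) / 4)) _ x :=
    hasDerivAt_of_eq_quartic (-(-s^4/(p+4) + 2*s^2/(p+2))/4)
      (-(-4*s^3/(p+4) + 4*s^3/(p+3) + 4*s/(p+2) - 4*s/(p+1))/4)
      (-(-6*s^2/(p+4) + 12*s^2/(p+3) + (2-6*s^2)/(p+2) - 4/(p+1))/4)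
      (-(-4*s/(p+4) + 12*s/(p+3) - 12*s/(p+2) + 4*s/(p+1))/4)
      (-(-1/(p+4) + 4/(p+3) - 6/(p+2) + 4/(p+1))/4) x (fun x => by ring)
  have h := hasDerivAt_mul_psi_add_mul_rpow (p := p) hx hA hB
  rw [show tentEnd p s = _ from funext fun x => by rw [tentEnd, sub_eq_add_neg, ← neg_mul]]
  refine h.congr_deriv ?_
  unfold tentEnd₁
  rcases hs with rfl | rfl <;> field_simp <;> ring

lemma hasDerivAt_tentEnd₁ (hp : -1 < p) (hs : s = 1 ∨ s = -1) (hx : x + s ≠ 0) :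
    HasDerivAt (tentEnd₁ p s) (tentEnd₂ p s x) x := by
  have h1 : p + 1 ≠ 0 := by linarith
  have h2 : p + 2 ≠ 0 := by linarith
  have h3 : p + 3 ≠ 0 := by linarith
  have hA : HasDerivAt (fun x : ℝ => x ^ 3 - x) _ x :=
    hasDerivAt_of_eq_quartic 0 (-1) 0 1 0 x (fun x => by ring)
  have hB : HasDerivAt (fun x => -((x + s) ^ 3 / (p + 3) - 3 * x * (x + s) ^ 2 / (p + 2)
        + (3 * x ^ 2 - 1) * (x + s) / (p + 1))) _ x :=
    hasDerivAt_of_eq_quartic (-(s^3/(p+3) - s/(p+1)))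
      (-(3*s^2/(p+3) - 3*s^2/(p+2) - 1/(p+1))) (-(3*s/(p+3) - 6*s/(p+2) + 3*s/(p+1)))
      (-(1/(p+3) - 3/(p+2) + 3/(p+1))) 0 x (fun x => by ring)
  have h := hasDerivAt_mul_psi_add_mul_rpow (p := p) hx hA hB
  rw [show tentEnd₁ p s = _ from funext fun x => by rw [tentEnd₁, sub_eq_add_neg, ← neg_mul]]
  refine h.congr_deriv ?_
  unfold tentEnd₂
  rcases hs with rfl | rfl <;> field_simp <;> ring

lemma hasDerivAt_tentEnd₂ (hp : -1 < p) (hs : s = 1 ∨ s = -1) (hx : x + s ≠ 0) :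
    HasDerivAt (tentEnd₂ p s) (tentEnd₃ p s x) x := by
  have h1 : p + 1 ≠ 0 := by linarith
  have h2 : p + 2 ≠ 0 := by linarith
  have hA : HasDerivAt (fun x : ℝ => 3 * x ^ 2 - 1) _ x :=
    hasDerivAt_of_eq_quartic (-1) 0 3 0 0 x (fun x => by ring)
  have hB : HasDerivAt (fun x => 3 * (x + s) ^ 2 / (p + 2) - 6 * x * (x + s) / (p + 1)) _ x :=
    hasDerivAt_of_eq_quartic (3*s^2/(p+2)) (6*s/(p+2) - 6*s/(p+1)) (3/(p+2) - 6/(p+1))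
      0 0 x (fun x => by ring)
  refine (hasDerivAt_mul_psi_add_mul_rpow (p := p) hx hA hB).congr_deriv ?_
  unfold tentEnd₃
  rcases hs with rfl | rfl <;> field_simp <;> ring

lemma hasDerivAt_tentEnd₃ (hp : -1 < p) (hs : s = 1 ∨ s = -1) (hx : x + s ≠ 0) :
    HasDerivAt (tentEnd₃ p s) (tentEnd₄ p s x) x := by
  have h1 : p + 1 ≠ 0 := by linarith
  have hA : HasDerivAt (fun x : ℝ => 6 * x) _ x :=
    hasDerivAt_of_eq_quartic 0 6 0 0 0 x (fun x => by ring)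
  have hN : HasDerivAt (fun x : ℝ => 3 * x ^ 2 - 1) _ x :=
    hasDerivAt_of_eq_quartic (-1) 0 3 0 0 x (fun x => by ring)
  have hB : HasDerivAt (fun x => 3 * (p - 1) / (p + 1) * (x + s) - 6 * x) _ x :=
    hasDerivAt_of_eq_quartic (3*(p-1)/(p+1)*s) (3*(p-1)/(p+1) - 6) 0 0 0 x (fun x => by ring)
  have h := hasDerivAt_mul_psi_add_mul_rpow (p := p) hx hA
    ((hN.div ((hasDerivAt_id x).add_const s) hx).add hB)
  rw [show tentEnd₃ p s = _ from funext fun x => by rw [tentEnd₃, add_sub_assoc]]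
  refine h.congr_deriv ?_
  unfold tentEnd₄
  simp only [Pi.add_apply, Pi.div_apply, id]
  rcases hs with rfl | rfl <;> field_simp <;> ring

end Derivatives

/-- `∫₀¹ (ξ - ξ³) (ψ(x+ξ) - ψ(x-ξ)) dξ` in closed form. -/
def tentN (p x : ℝ) : ℝ := tentEnd p 1 x - tentEnd p (-1) x

/-- First derivative of `tentN`. -/
def tentN₁ (p x : ℝ) : ℝ := tentEnd₁ p 1 x - tentEnd₁ p (-1) x

/-- Second derivative of `tentN`. -/
def tentN₂ (p x : ℝ) : ℝ := tentEnd₂ p 1 x - tentEnd₂ p (-1) x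

/-- Third derivative of `tentN`. -/
def tentN₃ (p x : ℝ) : ℝ := tentEnd₃ p 1 x - tentEnd₃ p (-1) x

/-- Fourth derivative of `tentN`. -/
def tentN₄ (p x : ℝ) : ℝ := tentEnd₄ p 1 x - tentEnd₄ p (-1) x

/-- The slope at the origin, in the variable `x²`, of the (negated) image of the unit tent. -/
def tentA (p : ℝ) : ℝ := 2 * (2 - p) / (3 * (p + 1))

/-- The slope, in the variable `x²`, of the (negated) image of the unit tent. -/
def tentV (p x : ℝ) : ℝ := (tentN p x - x * tentN₁ p x) / (2 * x ^ 3)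

section Tent

variable {p s x : ℝ}

lemma continuous_tentEnd (hp : -1 < p) (hs : s = 1 ∨ s = -1) : Continuous (tentEnd p s) := by
  have h1 := (continuous_mul_psi hp).comp (continuous_add_const s)
  have h2 := (continuous_mul_abs_rpow hp).comp (continuous_add_const s)
  have e : tentEnd p s = fun x => (x + s) * (x - s) ^ 2 / 4 * ((x + s) * psi p (x + s))
    - (-(x + s) ^ 3 / (p + 4) + 4 * x * (x + s) ^ 2 / (p + 3) + (2 - 6 * x ^ 2) * (x + s) / (p + 2)
      + (4 * x ^ 3 - 4 * x) / (p + 1)) / 4 * ((x + s) * |x + s| ^ p) := by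
    ext x
    unfold tentEnd
    rcases hs with rfl | rfl <;> ring
  rw [e]
  simp only [Function.comp_def] at h1 h2
  fun_prop

lemma continuous_tentEnd₁ (hp : -1 < p) (hs : s = 1 ∨ s = -1) : Continuous (tentEnd₁ p s) := by
  have h1 := (continuous_mul_psi hp).comp (continuous_add_const s)
  have h2 := (continuous_mul_abs_rpow hp).comp (continuous_add_const s)
  have e : tentEnd₁ p s = fun x => x * (x - s) * ((x + s) * psi p (x + s))
    - ((x + s) ^ 2 / (p + 3) - 3 * x * (x + s) / (p + 2)
      + (3 * x ^ 2 - 1) / (p + 1)) * ((x + s) * |x + s| ^ p) := by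
    ext x
    unfold tentEnd₁
    rcases hs with rfl | rfl <;> ring
  rw [e]
  simp only [Function.comp_def] at h1 h2
  fun_prop

lemma continuous_tentN (hp : -1 < p) : Continuous (tentN p) :=
  (continuous_tentEnd hp (Or.inl rfl)).sub (continuous_tentEnd hp (Or.inr rfl))

lemma continuous_tentN₁ (hp : -1 < p) : Continuous (tentN₁ p) :=
  (continuous_tentEnd₁ hp (Or.inl rfl)).sub (continuous_tentEnd₁ hp (Or.inr rfl))

lemma hasDerivAt_tentN₁ (hp : -1 < p) (hx : -1 < x) (hx1 : x ≠ 1) :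
    HasDerivAt (tentN₁ p) (tentN₂ p x) x :=
  (hasDerivAt_tentEnd₁ hp (Or.inl rfl) (by linarith)).sub
    (hasDerivAt_tentEnd₁ hp (Or.inr rfl) (fun h => hx1 (by linarith)))

lemma hasDerivAt_tentN₂ (hp : -1 < p) (hx : -1 < x) (hx1 : x ≠ 1) :
    HasDerivAt (tentN₂ p) (tentN₃ p x) x :=
  (hasDerivAt_tentEnd₂ hp (Or.inl rfl) (by linarith)).sub
    (hasDerivAt_tentEnd₂ hp (Or.inr rfl) (fun h => hx1 (by linarith)))

lemma hasDerivAt_tentN₃ (hp : -1 < p) (hx : -1 < x) (hx1 : x ≠ 1) :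
    HasDerivAt (tentN₃ p) (tentN₄ p x) x :=
  (hasDerivAt_tentEnd₃ hp (Or.inl rfl) (by linarith)).sub
    (hasDerivAt_tentEnd₃ hp (Or.inr rfl) (fun h => hx1 (by linarith)))

lemma hasDerivAt_tentEnd_of_forall (hp : -1 < p) (hs : s = 1 ∨ s = -1) (x : ℝ) :
    HasDerivAt (tentEnd p s) (tentEnd₁ p s x) x :=
  hasDerivAt_of_hasDerivAt_of_ne' (x := -s)
    (fun y hy => hasDerivAt_tentEnd hp hs (fun h => hy (by linarith)))
    (continuous_tentEnd hp hs).continuousAt (continuous_tentEnd₁ hp hs).continuousAt x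

lemma hasDerivAt_tentN (hp : -1 < p) (x : ℝ) : HasDerivAt (tentN p) (tentN₁ p x) x :=
  (hasDerivAt_tentEnd_of_forall hp (Or.inl rfl) x).sub
    (hasDerivAt_tentEnd_of_forall hp (Or.inr rfl) x)

lemma tentN_zero : tentN p 0 = 0 := by
  simp [tentN, tentEnd, psi]
  norm_num

lemma tentN₁_zero (hp : -1 < p) : tentN₁ p 0 = 4 / ((p + 1) * (p + 3)) := by
  have h1 : p + 1 ≠ 0 := by linarith
  have h3 : p + 3 ≠ 0 := by linarith
  simp [tentN₁, tentEnd₁, psi]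
  field_simp
  ring

lemma tentN₂_zero : tentN₂ p 0 = 0 := by
  simp [tentN₂, tentEnd₂, psi]

lemma tentN₃_zero (hp : -1 < p) : tentN₃ p 0 = -(6 * tentA p) := by
  have h1 : p + 1 ≠ 0 := by linarith
  simp [tentN₃, tentEnd₃, psi, tentA]
  field_simp
  ring

lemma nonneg_of_hasDerivAt_nonneg {f f' : ℝ → ℝ} {b : ℝ} (h0 : f 0 = 0)
    (hf : ∀ x, 0 ≤ x → x < b → HasDerivAt f (f' x) x) (hf' : ∀ x, 0 < x → x < b → 0 ≤ f' x)
    (x : ℝ) (hx : 0 ≤ x) (hxb : x < b) : 0 ≤ f x := by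
  have h : MonotoneOn f (Icc 0 x) := by
    refine monotoneOn_of_deriv_nonneg (convex_Icc 0 x)
      (fun y hy => (hf y hy.1 (hy.2.trans_lt hxb)).continuousAt.continuousWithinAt) ?_ ?_
    · intro y hy
      rw [interior_Icc] at hy
      exact (hf y hy.1.le (hy.2.trans hxb)).differentiableAt.differentiableWithinAt
    · intro y hy
      rw [interior_Icc] at hy
      rw [(hf y hy.1.le (hy.2.trans hxb)).deriv]
      exact hf' y hy.1 (hy.2.trans hxb)
  rw [← h0]
  exact h (left_mem_Icc.mpr hx) (right_mem_Icc.mpr hx) hx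

lemma tentN₄_nonneg (hp1 : p < 1) (hx : 0 < x) (hx1 : x < 1) : 0 ≤ tentN₄ p x := by
  have hu : 0 < x + 1 := by linarith
  have hv : 0 < 1 - x := by linarith
  have hD : psi p (1 - x) ≤ psi p (x + 1) := psi_mono hv (by linarith)
  have h1 : (x + 1) ^ (p - 1) ≤ (1 - x) ^ (p - 1) :=
    Real.rpow_le_rpow_of_nonpos hv (by linarith) (by linarith)
  have h2 : (x + 1) ^ (p - 2) ≤ (1 - x) ^ (p - 2) :=
    Real.rpow_le_rpow_of_nonpos hv (by linarith) (by linarith)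
  rw [Real.rpow_sub_one hu.ne', Real.rpow_sub_one hv.ne'] at h1
  rw [show p - 2 = p - 1 - 1 by ring, Real.rpow_sub_one hu.ne', Real.rpow_sub_one hv.ne',
    Real.rpow_sub_one hu.ne', Real.rpow_sub_one hv.ne'] at h2
  have e : tentN₄ p x = 6 * (psi p (x + 1) - psi p (1 - x))
      + 6 * ((1 - x) ^ p / (1 - x) - (x + 1) ^ p / (x + 1))
      + 2 * (1 - p) * ((1 - x) ^ p / (1 - x) / (1 - x) - (x + 1) ^ p / (x + 1) / (x + 1)) := by
    unfold tentN₄ tentEnd₄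
    rw [abs_of_pos hu, show x + -1 = -(1 - x) by ring, psi_neg, abs_neg, abs_of_pos hv]
    field_simp
    ring
  rw [e]
  have : 0 ≤ (1 - p) * ((1 - x) ^ p / (1 - x) / (1 - x) - (x + 1) ^ p / (x + 1) / (x + 1)) :=
    mul_nonneg (by linarith) (by linarith)
  linarith

lemma tentN₃_lower (hp : -1 < p) (hp1 : p < 1) (hx : 0 ≤ x) (hx1 : x < 1) :
    0 ≤ 6 * tentA p + tentN₃ p x :=
  nonneg_of_hasDerivAt_nonneg (f := fun x => 6 * tentA p + tentN₃ p x) (f' := tentN₄ p) (b := 1)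
    (by simp [tentN₃_zero hp])
    (fun y h0 h1 => (hasDerivAt_tentN₃ hp (by linarith) h1.ne).const_add _)
    (fun y h0 h1 => tentN₄_nonneg hp1 h0 h1) x hx hx1

lemma tentN₂_lower (hp : -1 < p) (hp1 : p < 1) (hx : 0 ≤ x) (hx1 : x < 1) :
    0 ≤ 6 * tentA p * x + tentN₂ p x :=
  nonneg_of_hasDerivAt_nonneg (f := fun x => 6 * tentA p * x + tentN₂ p x)
    (f' := fun x => 6 * tentA p + tentN₃ p x) (b := 1) (by simp [tentN₂_zero])
    (fun y h0 h1 => (((hasDerivAt_id y).const_mul (6 * tentA p)).add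
      (hasDerivAt_tentN₂ hp (by linarith) h1.ne)).congr_deriv (by ring))
    (fun y h0 h1 => tentN₃_lower hp hp1 h0.le h1) x hx hx1

lemma tentV_numerator_lower (hp : -1 < p) (hp1 : p < 1) (hx : 0 ≤ x) (hx1 : x < 1) :
    0 ≤ 2 * tentA p * x ^ 3 + (x * tentN₁ p x - tentN p x) :=
  nonneg_of_hasDerivAt_nonneg (f := fun x => 2 * tentA p * x ^ 3 + (x * tentN₁ p x - tentN p x))
    (f' := fun x => x * (6 * tentA p * x + tentN₂ p x)) (b := 1) (by simp [tentN_zero])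
    (fun y h0 h1 => (((hasDerivAt_pow 3 y).const_mul (2 * tentA p)).add
      (((hasDerivAt_id y).mul (hasDerivAt_tentN₁ hp (by linarith) h1.ne)).sub
        (hasDerivAt_tentN hp y))).congr_deriv (by norm_num; ring))
    (fun y h0 h1 => mul_nonneg h0.le (tentN₂_lower hp hp1 h0.le h1)) x hx hx1

end Tent

/-- An antiderivative of `y ↦ (2-p)(4-p)/64 * (y⁴ - 2(1+x²)y² + (x²-1)²)² y^(p-5)`. -/
def tentB (p x y : ℝ) : ℝ :=
  (2 - p) * (4 - p) / 64 * (y ^ 4 / (p + 4) - 4 * (1 + x ^ 2) * y ^ 2 / (p + 2)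
    - 4 * (1 + x ^ 2) * (x ^ 2 - 1) ^ 2 / ((p - 2) * y ^ 2)
    + (x ^ 2 - 1) ^ 4 / ((p - 4) * y ^ 4)) * |y| ^ p
  + (2 - p) * (4 - p) / 64 * (4 * (1 + x ^ 2) ^ 2 + 2 * (x ^ 2 - 1) ^ 2) * psi p y

section Tent

variable {p s x : ℝ}

lemma hasDerivAt_tentB (hp : -1 < p) (hp1 : p < 1) {y : ℝ} (hy : 0 < y) :
    HasDerivAt (tentB p x) ((2 - p) * (4 - p) / 64
      * (y ^ 4 - 2 * (1 + x ^ 2) * y ^ 2 + (x ^ 2 - 1) ^ 2) ^ 2 / y ^ 5 * y ^ p) y := by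
  have h1 : p + 4 ≠ 0 := by linarith
  have h2 : p + 2 ≠ 0 := by linarith
  have h3 : p - 2 ≠ 0 := by linarith
  have h4 : p - 4 ≠ 0 := by linarith
  have hy0 := hy.ne'
  have hA : HasDerivAt (fun y : ℝ => (2 - p) * (4 - p) / 64 *
      (y ^ 4 / (p + 4) - 4 * (1 + x ^ 2) * y ^ 2 / (p + 2)
      - 4 * (1 + x ^ 2) * (x ^ 2 - 1) ^ 2 / ((p - 2) * y ^ 2)
      + (x ^ 2 - 1) ^ 4 / ((p - 4) * y ^ 4))) _ y :=
    (((((hasDerivAt_pow 4 y).div_const (p + 4)).sub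
      (((hasDerivAt_pow 2 y).const_mul (4 * (1 + x ^ 2))).div_const (p + 2))).sub
      ((hasDerivAt_const y (4 * (1 + x ^ 2) * (x ^ 2 - 1) ^ 2)).div
        ((hasDerivAt_pow 2 y).const_mul (p - 2)) (by positivity))).add
      ((hasDerivAt_const y ((x ^ 2 - 1) ^ 4)).div
        ((hasDerivAt_pow 4 y).const_mul (p - 4)) (by positivity))).const_mul _
  have h := (hA.mul (hasDerivAt_abs_rpow p hy0)).add ((hasDerivAt_psi p hy0).const_mul
    ((2 - p) * (4 - p) / 64 * (4 * (1 + x ^ 2) ^ 2 + 2 * (x ^ 2 - 1) ^ 2)))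
  refine h.congr_deriv ?_
  rw [abs_of_pos hy]
  norm_num
  field_simp
  ring

lemma tentB_neg (y : ℝ) : tentB p x (-y) = tentB p x y := by
  unfold tentB
  rw [psi_neg, abs_neg]
  ring

lemma tentB_le (hp : -1 < p) (hp1 : p < 1) {y z : ℝ} (hy : 0 < y) (hyz : y ≤ z) :
    tentB p x y ≤ tentB p x z := by
  have : MonotoneOn (tentB p x) (Ioi 0) := by
    refine monotoneOn_of_deriv_nonneg (convex_Ioi 0)
      (fun y hy => (hasDerivAt_tentB hp hp1 hy).continuousAt.continuousWithinAt) ?_ ?_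
    · intro y hy
      rw [interior_Ioi] at hy
      exact (hasDerivAt_tentB hp hp1 hy).differentiableAt.differentiableWithinAt
    · intro y hy
      rw [interior_Ioi] at hy
      rw [(hasDerivAt_tentB hp hp1 hy).deriv]
      have : (0:ℝ) < y := hy
      have h2 : 0 < 2 - p := by linarith
      have h4 : 0 < 4 - p := by linarith
      positivity
  exact this hy (hy.trans_le hyz : 0 < z) hyz

lemma tentN_combination_eq (hp : -1 < p) (hp1 : p < 1) (hx : 0 < x) (hx1 : x ≠ 1) :
    x ^ 2 * tentN₂ p x - 3 * x * tentN₁ p x + 3 * tentN p x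
      = tentB p x (x + 1) - tentB p x (x - 1) := by
  have h1 : p + 1 ≠ 0 := by linarith
  have h2 : p + 2 ≠ 0 := by linarith
  have h3 : p + 3 ≠ 0 := by linarith
  have h4 : p + 4 ≠ 0 := by linarith
  have h5 : p - 2 ≠ 0 := by linarith
  have h6 : p - 4 ≠ 0 := by linarith
  have hu : x + 1 ≠ 0 := by linarith
  have hw : x - 1 ≠ 0 := sub_ne_zero.mpr hx1
  have eu : ∀ y z : ℝ, y ≠ 0 → (x ^ 2 - 1) = y * z → tentB p x y =
      (2 - p) * (4 - p) / 64 * (y ^ 4 / (p + 4) - 4 * (1 + x ^ 2) * y ^ 2 / (p + 2)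
    - 4 * (1 + x ^ 2) * z ^ 2 / (p - 2) + z ^ 4 / (p - 4)) * |y| ^ p
  + (2 - p) * (4 - p) / 64 * (4 * (1 + x ^ 2) ^ 2 + 2 * (x ^ 2 - 1) ^ 2) * psi p y := by
    intro y z hy h
    unfold tentB
    rw [h]
    congr 2
    field_simp
  rw [eu (x + 1) (x - 1) hu (by ring), eu (x - 1) (x + 1) hw (by ring)]
  unfold tentN tentN₁ tentN₂ tentEnd tentEnd₁ tentEnd₂
  rw [← sub_eq_add_neg x 1]
  have hU := mul_psi p (x + 1)
  have hW := mul_psi p (x - 1)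
  generalize psi p (x + 1) = a at *
  generalize psi p (x - 1) = b at *
  generalize |x + 1| ^ p = P at *
  generalize |x - 1| ^ p = W at *
  obtain rfl : P = p * a + 1 := by linarith
  obtain rfl : W = p * b + 1 := by linarith
  field_simp
  ring

lemma tentN_combination_nonneg (hp : -1 < p) (hp1 : p < 1) (hx : 0 < x) (hx1 : x ≠ 1) :
    0 ≤ x ^ 2 * tentN₂ p x - 3 * x * tentN₁ p x + 3 * tentN p x := by
  rw [tentN_combination_eq hp hp1 hx hx1, sub_nonneg]
  rcases hx1.lt_or_gt with h | h
  · rw [← tentB_neg]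
    exact tentB_le hp hp1 (by linarith) (by linarith)
  · exact tentB_le hp hp1 (by linarith) (by linarith)

lemma hasDerivAt_tentV (hp : -1 < p) (hx : 0 < x) (hx1 : x ≠ 1) :
    HasDerivAt (tentV p)
      (-(x ^ 2 * tentN₂ p x - 3 * x * tentN₁ p x + 3 * tentN p x) / (2 * x ^ 4)) x := by
  have h := ((hasDerivAt_tentN hp x).sub ((hasDerivAt_id x).mul
    (hasDerivAt_tentN₁ hp (by linarith) hx1))).div ((hasDerivAt_pow 3 x).const_mul 2)
    (by positivity)
  refine h.congr_deriv ?_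
  simp
  field_simp
  ring

lemma continuousOn_tentV (hp : -1 < p) : ContinuousOn (tentV p) (Ioi 0) := by
  have h1 := continuous_tentN hp
  have h2 := continuous_tentN₁ hp
  unfold tentV
  refine ContinuousOn.div (by fun_prop) (by fun_prop) fun y hy => ?_
  have : (0:ℝ) < y := hy
  positivity

lemma tentV_antitoneOn (hp : -1 < p) (hp1 : p < 1) : AntitoneOn (tentV p) (Ioi 0) := by
  have key : ∀ s : Set ℝ, Convex ℝ s → s ⊆ Ioi 0 → (∀ x ∈ interior s, x ≠ 1) →
      AntitoneOn (tentV p) s := by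
    intro s hs h0 h1
    have hd : ∀ x ∈ interior s, HasDerivAt (tentV p) _ x := fun x hx =>
      hasDerivAt_tentV hp (h0 (interior_subset hx)) (h1 x hx)
    refine antitoneOn_of_deriv_nonpos hs ((continuousOn_tentV hp).mono h0)
      (fun x hx => (hd x hx).differentiableAt.differentiableWithinAt) fun x hx => ?_
    rw [(hd x hx).deriv, neg_div]
    have := tentN_combination_nonneg hp hp1 (h0 (interior_subset hx)) (h1 x hx)
    have : 0 < x := h0 (interior_subset hx)
    rw [neg_nonpos]
    positivity
  have h1 := key (Ioc 0 1) (convex_Ioc 0 1) (fun x hx => hx.1)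
    (fun x hx => by rw [interior_Ioc] at hx; exact hx.2.ne)
  have h2 := key (Ici 1) (convex_Ici 1) (fun x hx => mem_Ioi.mpr (one_pos.trans_le hx))
    (fun x hx => by rw [interior_Ici] at hx; exact hx.ne')
  rw [← Ioc_union_Ici_eq_Ioi (show (0:ℝ) < 1 by norm_num)]
  exact h1.union_right h2 (isGreatest_Ioc one_pos) isLeast_Ici

lemma tentV_le (hp : -1 < p) (hp1 : p < 1) (hx : 0 < x) : tentV p x ≤ tentA p := by
  have key : ∀ x, 0 < x → x < 1 → tentV p x ≤ tentA p := by
    intro x h0 h1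
    rw [tentV, div_le_iff₀ (by positivity)]
    linarith [tentV_numerator_lower hp hp1 h0.le h1]
  rcases lt_or_ge x 1 with h | h
  · exact key x hx h
  · exact (tentV_antitoneOn hp hp1 (by norm_num : (0:ℝ) < 1/2) hx (by linarith)).trans
      (key (1/2) (by norm_num) (by norm_num))

lemma tentV_one (hp : -1 < p) :
    tentV p 1 = (2 - p) / 2 * 2 ^ (p + 2) / ((p + 1) * (p + 2) * (p + 4)) := by
  have h1 : p + 1 ≠ 0 := by linarith
  have h2 : p + 2 ≠ 0 := by linarith
  have h3 : p + 3 ≠ 0 := by linarith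
  have h4 : p + 4 ≠ 0 := by linarith
  have e : (2:ℝ) ^ (p + 2) = 2 ^ p * 4 := by
    rw [Real.rpow_add (by norm_num)]
    norm_num
  rw [e]
  simp [tentV, tentN, tentN₁, tentEnd, tentEnd₁]
  norm_num
  field_simp
  ring

end Tent

section Kernel

variable {p s x t : ℝ}

lemma continuousOn_psi (p : ℝ) : ContinuousOn (psi p) {0}ᶜ :=
  fun _ hy => (hasDerivAt_psi p hy).continuousAt.continuousWithinAt

/-- An antiderivative of `ξ ↦ (ξ - ξ³) (ψ(x+ξ) - ψ(x-ξ))`. -/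
def tentPrim (p x ξ : ℝ) : ℝ :=
  (ξ ^ 2 / 2 - ξ ^ 4 / 4 - (x ^ 2 / 2 - x ^ 4 / 4)) * (psi p (x + ξ) - psi p (x - ξ))
    - (-(x + ξ) ^ 3 / (p + 4) + 4 * x * (x + ξ) ^ 2 / (p + 3)
        + (2 - 6 * x ^ 2) * (x + ξ) / (p + 2) + (4 * x ^ 3 - 4 * x) / (p + 1)) / 4
      * ((x + ξ) * |x + ξ| ^ p)
    + (-(x - ξ) ^ 3 / (p + 4) + 4 * x * (x - ξ) ^ 2 / (p + 3)
        + (2 - 6 * x ^ 2) * (x - ξ) / (p + 2) + (4 * x ^ 3 - 4 * x) / (p + 1)) / 4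
      * ((x - ξ) * |x - ξ| ^ p)

lemma tentPrim_zero : tentPrim p x 0 = 0 := by
  simp [tentPrim]

lemma tentPrim_one : tentPrim p x 1 = tentN p x := by
  unfold tentPrim tentN tentEnd
  rw [← sub_eq_add_neg x 1]
  ring

lemma continuousOn_tentPrim (hp : -1 < p) (hx : 0 < x) :
    ContinuousOn (tentPrim p x) (Ici 0) := by
  have h1 := continuous_mul_psi hp
  have h2 := continuous_mul_abs_rpow hp
  have h3 : ContinuousOn (fun ξ => psi p (x + ξ)) (Ici 0) :=
    (continuousOn_psi p).comp (by fun_prop) fun ξ hξ => by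
      have : (0:ℝ) ≤ ξ := hξ
      exact (by positivity : x + ξ ≠ 0)
  have h4 : Continuous (fun ξ => (x - ξ) * psi p (x - ξ)) := h1.comp (by fun_prop)
  have h5 : Continuous (fun ξ => (x - ξ) * |x - ξ| ^ p) := h2.comp (by fun_prop)
  have h6 : Continuous (fun ξ => (x + ξ) * |x + ξ| ^ p) := h2.comp (by fun_prop)
  have e : tentPrim p x = fun ξ =>
    (ξ ^ 2 / 2 - ξ ^ 4 / 4 - (x ^ 2 / 2 - x ^ 4 / 4)) * psi p (x + ξ)
    + (x + ξ) * (2 - x ^ 2 - ξ ^ 2) / 4 * ((x - ξ) * psi p (x - ξ))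
    - (-(x + ξ) ^ 3 / (p + 4) + 4 * x * (x + ξ) ^ 2 / (p + 3)
        + (2 - 6 * x ^ 2) * (x + ξ) / (p + 2) + (4 * x ^ 3 - 4 * x) / (p + 1)) / 4
      * ((x + ξ) * |x + ξ| ^ p)
    + (-(x - ξ) ^ 3 / (p + 4) + 4 * x * (x - ξ) ^ 2 / (p + 3)
        + (2 - 6 * x ^ 2) * (x - ξ) / (p + 2) + (4 * x ^ 3 - 4 * x) / (p + 1)) / 4
      * ((x - ξ) * |x - ξ| ^ p) := by
    ext ξ
    unfold tentPrim
    ring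
  rw [e]
  fun_prop

lemma hasDerivAt_tentPrim (hp : -1 < p) {ξ : ℝ} (h0 : x + ξ ≠ 0) (h1 : x - ξ ≠ 0) :
    HasDerivAt (tentPrim p x) ((ξ - ξ ^ 3) * (psi p (x + ξ) - psi p (x - ξ))) ξ := by
  have hp1 : p + 1 ≠ 0 := by linarith
  have hp2 : p + 2 ≠ 0 := by linarith
  have hp3 : p + 3 ≠ 0 := by linarith
  have hp4 : p + 4 ≠ 0 := by linarith
  have hu : HasDerivAt (fun ξ => x + ξ) 1 ξ := (hasDerivAt_id ξ).const_add x
  have hv : HasDerivAt (fun ξ => x - ξ) (-1) ξ := (hasDerivAt_id ξ).const_sub x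
  have hS : ∀ u : ℝ, HasDerivAt (fun u : ℝ => (-u ^ 3 / (p + 4) + 4 * x * u ^ 2 / (p + 3)
        + (2 - 6 * x ^ 2) * u / (p + 2) + (4 * x ^ 3 - 4 * x) / (p + 1)) / 4 * u) _ u := fun u =>
    hasDerivAt_of_eq_quartic 0 ((4 * x ^ 3 - 4 * x) / (p + 1) / 4)
      ((2 - 6 * x ^ 2) / (p + 2) / 4) (4 * x / (p + 3) / 4) (-1 / (p + 4) / 4) u
      (fun x => by ring)
  have hT : ∀ u : ℝ, u ≠ 0 → HasDerivAt (fun u : ℝ =>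
      (-u ^ 3 / (p + 4) + 4 * x * u ^ 2 / (p + 3)
        + (2 - 6 * x ^ 2) * u / (p + 2) + (4 * x ^ 3 - 4 * x) / (p + 1)) / 4 * (u * |u| ^ p))
      ((-u ^ 3 + 4 * x * u ^ 2 + (2 - 6 * x ^ 2) * u + (4 * x ^ 3 - 4 * x)) / 4 * |u| ^ p) u := by
    intro u h
    have := (hS u).mul (hasDerivAt_abs_rpow p h)
    simp only [← mul_assoc]
    refine this.congr_deriv ?_
    field_simp
    ring
  have hR : HasDerivAt (fun ξ : ℝ => ξ ^ 2 / 2 - ξ ^ 4 / 4 - (x ^ 2 / 2 - x ^ 4 / 4)) _ ξ :=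
    hasDerivAt_of_eq_quartic (-(x ^ 2 / 2 - x ^ 4 / 4)) 0 (1 / 2) 0 (-1 / 4) ξ (fun x => by ring)
  have hψ := ((hasDerivAt_psi p h0).comp ξ hu).sub ((hasDerivAt_psi p h1).comp ξ hv)
  have h := ((hR.mul hψ).sub ((hT _ h0).comp ξ hu)).add ((hT _ h1).comp ξ hv)
  refine h.congr_deriv ?_
  simp only [Pi.sub_apply, Function.comp_apply]
  field_simp
  ring

/-- The kernel of `𝒯`, for `x > 0`, with `p = 1 - 2α`, up to the constant factor. -/
def ker (p x ξ : ℝ) : ℝ := ξ / x * (psi p (x + ξ) - psi p (x - ξ)) - 2 * ξ ^ p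

end Kernel

section Kernel

variable {p x t : ℝ}

lemma intervalIntegrable_psi (hp : -1 < p) (a b : ℝ) : IntervalIntegrable (psi p) volume a b := by
  refine intervalIntegrable_of_even (fun y => (psi_neg p y).symm) fun y hy => ?_
  by_cases h : p = 0
  · have : psi p = Real.log := by ext z; simp [psi, h]
    rw [this]
    exact intervalIntegral.intervalIntegrable_log'
  · have h1 := ((intervalIntegral.intervalIntegrable_rpow' hp (a := 0) (b := y)).sub
      (intervalIntegrable_const (c := (1:ℝ)))).div_const p
    refine h1.congr fun z hz => ?_
    rw [uIoc_of_le hy.le] at hz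
    simp [psi, h, abs_of_pos hz.1]

lemma intervalIntegrable_psi_sub (hp : -1 < p) (x a b : ℝ) :
    IntervalIntegrable (fun ξ => psi p (x + ξ) - psi p (x - ξ)) volume a b := by
  have h1 := (intervalIntegrable_psi hp (x + a) (x + b)).comp_add_left x
  have h2 := (intervalIntegrable_psi hp (x - a) (x - b)).comp_sub_left x
  simp only [add_sub_cancel_left, sub_sub_cancel] at h1 h2
  exact h1.sub h2

lemma intervalIntegrable_ker (hp : -1 < p) (x a b : ℝ) :
    IntervalIntegrable (ker p x) volume a b :=
  ((intervalIntegrable_psi_sub hp x a b).continuousOn_mul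
    (continuous_id.div_const x).continuousOn).sub
    ((intervalIntegral.intervalIntegrable_rpow' hp).const_mul 2)

lemma integral_tentN (hp : -1 < p) (hx : 0 < x) :
    ∫ ξ in (0:ℝ)..1, (ξ - ξ ^ 3) * (psi p (x + ξ) - psi p (x - ξ)) = tentN p x := by
  rw [integral_eq_of_hasDerivAt_off_countable_of_le (tentPrim p x) _ zero_le_one
    (countable_singleton x) ((continuousOn_tentPrim hp hx).mono Icc_subset_Ici_self)
    (fun ξ hξ => hasDerivAt_tentPrim hp (by linarith [hξ.1.1])
      (sub_ne_zero.mpr fun h => hξ.2 h.symm))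
    ((intervalIntegrable_psi_sub hp x 0 1).continuousOn_mul (by fun_prop)),
    tentPrim_zero, tentPrim_one, sub_zero]

/-- The negative of `∫₀¹ (1 - ξ²) ker p x ξ dξ`. -/
def tentE (p x : ℝ) : ℝ := if x = 0 then 0 else 4 / ((p + 1) * (p + 3)) - tentN p x / x

lemma integral_one_sub_sq_mul_ker (hp : -1 < p) (hx : 0 < x) :
    ∫ ξ in (0:ℝ)..1, (1 - ξ ^ 2) * ker p x ξ = -tentE p x := by
  have h1 : p + 1 ≠ 0 := by linarith
  have h3 : p + 3 ≠ 0 := by linarith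
  have e : EqOn (fun ξ : ℝ => (1 - ξ ^ 2) * ker p x ξ)
      (fun ξ => 1 / x * ((ξ - ξ ^ 3) * (psi p (x + ξ) - psi p (x - ξ)))
        - 2 * (ξ ^ p - ξ ^ (p + 2))) (uIoo 0 1) := by
    intro ξ hξ
    rw [uIoo_of_le zero_le_one] at hξ
    have := Real.rpow_add hξ.1 p 2
    rw [Real.rpow_two] at this
    simp only [this, ker]
    ring
  have i1 : IntervalIntegrable (fun ξ : ℝ => ξ ^ p) volume 0 1 :=
    intervalIntegral.intervalIntegrable_rpow' hp
  have i2 : IntervalIntegrable (fun ξ : ℝ => ξ ^ (p + 2)) volume 0 1 :=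
    intervalIntegral.intervalIntegrable_rpow' (by linarith)
  rw [intervalIntegral.integral_congr_uIoo e, intervalIntegral.integral_sub
    (((intervalIntegrable_psi_sub hp x 0 1).continuousOn_mul (by fun_prop)).const_mul _)
    ((i1.sub i2).const_mul 2), intervalIntegral.integral_const_mul,
    intervalIntegral.integral_const_mul, intervalIntegral.integral_sub i1 i2, integral_tentN hp hx,
    integral_rpow (Or.inl hp), integral_rpow (Or.inl (by linarith)), tentE, if_neg hx.ne']
  have h1' : p + 2 + 1 ≠ 0 := by linarith
  rw [Real.zero_rpow h1, Real.zero_rpow h1']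
  simp
  rw [show p + 2 + 1 = p + 3 by ring]
  field_simp
  ring

lemma ker_mul (ht : 0 < t) {ξ : ℝ} (hξ : 0 < ξ) (hx : 0 < x) (hne : ξ ≠ x / t) :
    ker p x (t * ξ) = t ^ p * ker p (x / t) ξ := by
  have h : x = t * (x / t) := by field_simp
  have h0 : 0 < x / t := by positivity
  generalize x / t = y at *
  subst h
  unfold ker
  rw [← mul_add, ← mul_sub, psi_mul_sub ht (by positivity) (sub_ne_zero.mpr hne.symm),
    Real.mul_rpow ht.le hξ.le]
  field_simp

lemma integral_tent_mul_ker (hp : -1 < p) (hx : 0 < x) (ht : 0 < t) :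
    ∫ ξ in (0:ℝ)..t, (1 - ξ ^ 2 / t ^ 2) * ker p x ξ = -(t ^ (p + 1) * tentE p (x / t)) := by
  have h := intervalIntegral.mul_integral_comp_mul_left (a := 0) (b := 1)
    (f := fun ξ : ℝ => (1 - ξ ^ 2 / t ^ 2) * ker p x ξ) t
  rw [mul_zero, mul_one] at h
  rw [← h, ← mul_neg, ← integral_one_sub_sq_mul_ker hp (div_pos hx ht), Real.rpow_add_one ht.ne',
    mul_comm (t ^ p) t, mul_assoc, ← intervalIntegral.integral_const_mul (t ^ p)]
  congr 1
  refine intervalIntegral.integral_congr_ae ?_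
  filter_upwards [compl_mem_ae_iff.mpr (measure_singleton (x / t))] with ξ hξ hξ'
  rw [uIoc_of_le zero_le_one] at hξ'
  rw [ker_mul ht hξ'.1 hx hξ]
  field_simp

lemma psi_sub_lower (hp1 : p < 1) {ξ : ℝ} (h0 : 0 ≤ ξ) (hξ : ξ < x) :
    2 * ξ * x ^ (p - 1) ≤ psi p (x + ξ) - psi p (x - ξ) := by
  have := nonneg_of_hasDerivAt_nonneg (b := x)
    (f := fun ξ => psi p (x + ξ) - psi p (x - ξ) - 2 * ξ * x ^ (p - 1))
    (f' := fun ξ => (x + ξ) ^ (p - 1) + (x - ξ) ^ (p - 1) - 2 * x ^ (p - 1)) (by simp)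
    (fun y hy hyx => by
      have hu : HasDerivAt (fun ξ => x + ξ) 1 y := (hasDerivAt_id y).const_add x
      have hv : HasDerivAt (fun ξ => x - ξ) (-1) y := (hasDerivAt_id y).const_sub x
      have h1 : 0 < x + y := by linarith
      have h2 : 0 < x - y := by linarith
      have h := (((hasDerivAt_psi p h1.ne').comp y hu).sub
        ((hasDerivAt_psi p h2.ne').comp y hv)).sub
        (((hasDerivAt_id y).const_mul 2).mul_const (x ^ (p - 1)))
      refine h.congr_deriv ?_
      rw [Real.rpow_sub_one h1.ne', Real.rpow_sub_one h2.ne', abs_of_pos h1, abs_of_pos h2]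
      ring)
    (fun y hy hyx => sub_nonneg.mpr (two_mul_rpow_le_add (by linarith)
      (by rwa [abs_of_pos hy])))
    ξ h0 hξ
  linarith

lemma psi_sub_sub_deriv_lower (hp1 : p < 1) {ξ : ℝ} (h0 : 0 ≤ ξ) (hξ : ξ < x) :
    2 * (2 - p) * ξ * x ^ (p - 1) ≤ psi p (x + ξ) - psi p (x - ξ)
      - x * ((x + ξ) ^ (p - 1) - (x - ξ) ^ (p - 1)) := by
  have := nonneg_of_hasDerivAt_nonneg (b := x)
    (f := fun ξ => psi p (x + ξ) - psi p (x - ξ)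
      - x * ((x + ξ) ^ (p - 1) - (x - ξ) ^ (p - 1)) - 2 * (2 - p) * ξ * x ^ (p - 1))
    (f' := fun ξ => ((x + ξ) ^ (p - 1) + (x - ξ) ^ (p - 1) - 2 * x ^ (p - 1))
      + x * (1 - p) * ((x + ξ) ^ (p - 2) + (x - ξ) ^ (p - 2) - 2 * x ^ (p - 2))) (by simp)
    (fun y hy hyx => by
      have hu : HasDerivAt (fun ξ => x + ξ) 1 y := (hasDerivAt_id y).const_add x
      have hv : HasDerivAt (fun ξ => x - ξ) (-1) y := (hasDerivAt_id y).const_sub x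
      have h1 : 0 < x + y := by linarith
      have h2 : 0 < x - y := by linarith
      have hx : 0 < x := by linarith
      have h := ((((hasDerivAt_psi p h1.ne').comp y hu).sub
        ((hasDerivAt_psi p h2.ne').comp y hv)).sub
        (((hu.rpow_const (p := p - 1) (Or.inl h1.ne')).sub
          (hv.rpow_const (p := p - 1) (Or.inl h2.ne'))).const_mul x)).sub
        (((hasDerivAt_id y).const_mul (2 * (2 - p))).mul_const (x ^ (p - 1)))
      refine h.congr_deriv ?_
      rw [show p - 1 - 1 = p - 2 by ring, abs_of_pos h1, abs_of_pos h2,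
        ← mul_one_div, mul_one_div, ← Real.rpow_sub_one h1.ne', ← Real.rpow_sub_one h2.ne',
        show p - 1 = (p - 2) + 1 by ring, Real.rpow_add_one hx.ne']
      ring)
    (fun y hy hyx => by
      have hy' : |y| < x := by rwa [abs_of_pos hy]
      have h1 := two_mul_rpow_le_add (show p - 1 ≤ 0 by linarith) hy'
      have h2 := two_mul_rpow_le_add (show p - 2 ≤ 0 by linarith) hy'
      have hx : 0 < x := by linarith
      exact add_nonneg (by linarith) (mul_nonneg (mul_nonneg hx.le (by linarith)) (by linarith)))
    ξ h0 hξ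
  linarith

lemma ker_nonneg (hp1 : p < 1) {ξ : ℝ} (hx : 0 < x) (hξ : x < ξ) : 0 ≤ ker p x ξ := by
  have h := psi_sub_lower hp1 hx.le hξ
  have h0 : 0 < ξ := by linarith
  unfold ker
  rw [add_comm x ξ, show x - ξ = -(ξ - x) by ring, psi_neg, sub_nonneg]
  calc 2 * ξ ^ p = ξ / x * (2 * x * ξ ^ (p - 1)) := by
        rw [Real.rpow_sub_one h0.ne']
        field_simp
    _ ≤ _ := by gcongr

end Kernel

section Slope

variable {p x t : ℝ}

lemma antitoneOn_psi_sub_div (hp1 : p < 1) {ξ : ℝ} (hξ : 0 ≤ ξ) :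
    AntitoneOn (fun x => (psi p (x + ξ) - psi p (x - ξ)) / x - 2 * ξ * x ^ (p - 2)) (Ioi ξ) := by
  have hd : ∀ x ∈ Ioi ξ, HasDerivAt
      (fun x => (psi p (x + ξ) - psi p (x - ξ)) / x - 2 * ξ * x ^ (p - 2))
      (-(psi p (x + ξ) - psi p (x - ξ) - x * ((x + ξ) ^ (p - 1) - (x - ξ) ^ (p - 1))
        - 2 * (2 - p) * ξ * x ^ (p - 1)) / x ^ 2) x := by
    intro x hx
    have hx' : ξ < x := hx
    have h1 : 0 < x + ξ := by linarith
    have h2 : 0 < x - ξ := by linarith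
    have h0 : 0 < x := by linarith
    have h := ((((hasDerivAt_psi p h1.ne').comp_add_const x ξ).sub
      ((hasDerivAt_psi p h2.ne').comp_sub_const x ξ)).div (hasDerivAt_id x) h0.ne').sub
      (((hasDerivAt_id x).rpow_const (p := p - 2) (Or.inl h0.ne')).const_mul (2 * ξ))
    refine h.congr_deriv ?_
    rw [abs_of_pos h1, abs_of_pos h2, ← Real.rpow_sub_one h1.ne', ← Real.rpow_sub_one h2.ne',
      show p - 1 = (p - 2 - 1) + 1 + 1 by ring, Real.rpow_add_one h0.ne', Real.rpow_add_one h0.ne']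
    simp
    field_simp
    ring
  refine antitoneOn_of_deriv_nonpos (convex_Ioi ξ)
    (fun x hx => (hd x hx).continuousAt.continuousWithinAt) ?_ ?_ <;> rw [interior_Ioi]
  · exact fun x hx => (hd x hx).differentiableAt.differentiableWithinAt
  · intro x hx
    rw [(hd x hx).deriv]
    have := psi_sub_sub_deriv_lower hp1 hξ hx
    exact div_nonpos_of_nonpos_of_nonneg (by linarith) (sq_nonneg x)

lemma tentN_div_sub_antitoneOn (hp : -1 < p) (hp1 : p < 1) :
    AntitoneOn (fun x => tentN p x / x - 4 / 15 * x ^ (p - 2)) (Ioi 1) := by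
  have e : ∀ x : ℝ, 0 < x → tentN p x / x - 4 / 15 * x ^ (p - 2) = ∫ ξ in (0:ℝ)..1,
      (ξ - ξ ^ 3) * ((psi p (x + ξ) - psi p (x - ξ)) / x - 2 * ξ * x ^ (p - 2)) := by
    intro x hx
    have i1 : IntervalIntegrable (fun ξ : ℝ => (ξ - ξ ^ 3) * (psi p (x + ξ) - psi p (x - ξ)))
      volume 0 1 := (intervalIntegrable_psi_sub hp x 0 1).continuousOn_mul (by fun_prop)
    have h2 : ∫ ξ in (0:ℝ)..1, (ξ ^ 2 - ξ ^ 4) = 2 / 15 := by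
      rw [intervalIntegral.integral_sub (by simp) (by simp), integral_pow, integral_pow]
      norm_num
    rw [← integral_tentN hp hx, div_eq_mul_inv, ← intervalIntegral.integral_mul_const,
      show (4:ℝ) / 15 * x ^ (p - 2) = 2 / 15 * (2 * x ^ (p - 2)) by ring, ← h2,
      ← intervalIntegral.integral_mul_const, ← intervalIntegral.integral_sub (i1.mul_const _)
      (Continuous.intervalIntegrable (by fun_prop) _ _)]
    congr 1
    ext ξ
    ring
  have i : ∀ x : ℝ, IntervalIntegrable (fun ξ : ℝ => (ξ - ξ ^ 3) *
      ((psi p (x + ξ) - psi p (x - ξ)) / x - 2 * ξ * x ^ (p - 2))) volume 0 1 := fun x =>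
    (((intervalIntegrable_psi_sub hp x 0 1).div_const x).sub
      (Continuous.intervalIntegrable (by fun_prop) _ _)).continuousOn_mul (by fun_prop)
  intro x hx y hy hxy
  have hx' : (1:ℝ) < x := hx
  have hy' : (1:ℝ) < y := hy
  simp only
  rw [e x (by linarith), e y (by linarith)]
  refine intervalIntegral.integral_mono_on zero_le_one (i y) (i x) fun ξ hξ => ?_
  refine mul_le_mul_of_nonneg_left (antitoneOn_psi_sub_div hp1 hξ.1
    (lt_of_le_of_lt hξ.2 hx') (lt_of_le_of_lt hξ.2 hy') hxy) ?_
  have : ξ ^ 3 ≤ ξ ^ 1 := pow_le_pow_of_le_one hξ.1 hξ.2 (by norm_num)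
  linarith

lemma hasDerivAt_tentN_div (hp : -1 < p) (hx : 0 < x) :
    HasDerivAt (fun x => tentN p x / x) (-(2 * x * tentV p x)) x := by
  refine ((hasDerivAt_tentN hp x).div (hasDerivAt_id x) hx.ne').congr_deriv ?_
  simp [tentV]
  field_simp
  ring

lemma tentV_lower (hp : -1 < p) (hp1 : p < 1) (hx : 1 < x) :
    2 / 15 * (2 - p) * x ^ (p - 4) ≤ tentV p x := by
  have h0 : 0 < x := by linarith
  have h := (hasDerivAt_tentN_div hp h0).sub
    (((hasDerivAt_id x).rpow_const (p := p - 2) (Or.inl h0.ne')).const_mul (4 / 15))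
  have h2 := (tentN_div_sub_antitoneOn hp hp1).derivWithin_nonpos (x := x)
  rw [derivWithin_of_isOpen isOpen_Ioi hx] at h2
  have h3 := h.deriv
  simp only [Pi.sub_def, id] at h3
  rw [h3, show p - 2 - 1 = (p - 4) + 1 by ring, Real.rpow_add_one h0.ne'] at h2
  have : 0 ≤ 2 * x * (tentV p x - 2 / 15 * (2 - p) * x ^ (p - 4)) := by linarith
  have := nonneg_of_mul_nonneg_right this (by positivity)
  linarith

lemma tentV_nonneg (hp : -1 < p) (hp1 : p < 1) (hx : 0 < x) : 0 ≤ tentV p x := by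
  have hm : 1 < max x 2 := lt_of_lt_of_le one_lt_two (le_max_right _ _)
  refine le_trans ?_ (tentV_antitoneOn hp hp1 hx (hx.trans_le (le_max_left x 2)) (le_max_left x 2))
  refine le_trans ?_ (tentV_lower hp hp1 hm)
  have : 0 < 2 - p := by linarith
  positivity

lemma hasDerivAt_tentE_sqrt (hp : -1 < p) {s : ℝ} (hs : 0 < s) :
    HasDerivAt (fun s => tentE p √s) (tentV p √s) s := by
  have hr : 0 < √s := Real.sqrt_pos.mpr hs
  have h := (((hasDerivAt_tentN_div hp hr).const_sub (4 / ((p + 1) * (p + 3)))).comp s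
    (Real.hasDerivAt_sqrt hs.ne'))
  refine (h.congr_deriv (by field_simp)).congr_of_eventuallyEq ?_
  filter_upwards [lt_mem_nhds hs] with y hy
  simp [tentE, (Real.sqrt_pos.mpr hy).ne']

lemma continuousOn_tentE_sqrt (hp : -1 < p) : ContinuousOn (fun s => tentE p √s) (Ici 0) := by
  intro s hs
  rcases (show (0:ℝ) ≤ s from hs).eq_or_lt with rfl | h
  · have h1 : Tendsto (fun x => tentN p x / x) (nhdsWithin 0 {0}ᶜ)
        (nhds (4 / ((p + 1) * (p + 3)))) := by
      have := hasDerivAt_iff_tendsto_slope.mp (hasDerivAt_tentN hp 0)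
      rw [tentN₁_zero hp] at this
      refine this.congr fun x => ?_
      rw [slope_def_field, tentN_zero, sub_zero, sub_zero]
    have h2 : ContinuousAt (tentE p) 0 := by
      rw [continuousAt_iff_punctured_nhds]
      have := h1.const_sub (4 / ((p + 1) * (p + 3)))
      rw [sub_self] at this
      rw [show tentE p 0 = 0 by simp [tentE]]
      refine this.congr' ?_
      filter_upwards [self_mem_nhdsWithin] with x hx
      rw [tentE, if_neg (show x ≠ 0 from hx)]
    have h3 : ContinuousAt (fun s => tentE p √s) 0 :=
      ContinuousAt.comp (g := tentE p) (by rwa [Real.sqrt_zero])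
        Real.continuous_sqrt.continuousAt
    exact h3.continuousWithinAt
  · exact (hasDerivAt_tentE_sqrt hp h).continuousAt.continuousWithinAt

lemma tentE_sqrt_concaveOn (hp : -1 < p) (hp1 : p < 1) :
    ConcaveOn ℝ (Ici 0) (fun s => tentE p √s) := by
  refine AntitoneOn.concaveOn_of_deriv (convex_Ici 0) (continuousOn_tentE_sqrt hp) ?_ ?_ <;>
    rw [interior_Ici]
  · exact fun s hs => (hasDerivAt_tentE_sqrt hp hs).differentiableAt.differentiableWithinAt
  · intro s hs t ht hst
    rw [(hasDerivAt_tentE_sqrt hp hs).deriv, (hasDerivAt_tentE_sqrt hp ht).deriv]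
    exact tentV_antitoneOn hp hp1 (Real.sqrt_pos.mpr hs) (Real.sqrt_pos.mpr ht)
      (Real.sqrt_le_sqrt hst)

/-- Increments of `tentE` in the variable `x²` are controlled by bounds on its slope. -/
lemma mul_le_tentE_sqrt_sub (hp : -1 < p) {c s t : ℝ} (hs : 0 ≤ s) (hst : s ≤ t)
    (hc : ∀ r, s < r → r < t → c ≤ tentV p √r) :
    c * (t - s) ≤ tentE p √t - tentE p √s := by
  refine Convex.mul_sub_le_image_sub_of_le_deriv (convex_Icc s t)
    ((continuousOn_tentE_sqrt hp).mono fun r hr => hs.trans hr.1) ?_ ?_ s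
    (left_mem_Icc.mpr hst) t (right_mem_Icc.mpr hst) hst <;> rw [interior_Icc]
  · exact fun r hr => (hasDerivAt_tentE_sqrt hp
      (hs.trans_lt hr.1)).differentiableAt.differentiableWithinAt
  · intro r hr
    rw [(hasDerivAt_tentE_sqrt hp (hs.trans_lt hr.1)).deriv]
    exact hc r hr.1 hr.2

lemma tentE_sqrt_monotoneOn (hp : -1 < p) (hp1 : p < 1) :
    MonotoneOn (fun s => tentE p √s) (Ici 0) := by
  intro s hs t ht hst
  have := mul_le_tentE_sqrt_sub hp (c := 0) hs hst fun r hr _ =>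
    tentV_nonneg hp hp1 (Real.sqrt_pos.mpr (lt_of_le_of_lt hs hr))
  simp only
  linarith

lemma tentE_nonneg (hp : -1 < p) (hp1 : p < 1) (hx : 0 ≤ x) : 0 ≤ tentE p x := by
  have := tentE_sqrt_monotoneOn hp hp1 self_mem_Ici (sq_nonneg x : x ^ 2 ∈ Ici 0) (sq_nonneg x)
  simpa [Real.sqrt_sq hx, tentE] using this

lemma tentE_le (hp : -1 < p) (hp1 : p < 1) (hx : 0 ≤ x) : tentE p x ≤ tentA p * x ^ 2 := by
  have := Convex.image_sub_le_mul_sub_of_deriv_le (convex_Icc 0 (x ^ 2))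
    ((continuousOn_tentE_sqrt hp).mono fun r hr => hr.1) (C := tentA p) ?_ ?_ 0
    (left_mem_Icc.mpr (sq_nonneg x)) (x ^ 2) (right_mem_Icc.mpr (sq_nonneg x)) (sq_nonneg x)
  · simpa [Real.sqrt_sq hx, tentE] using this
  all_goals rw [interior_Icc]
  · exact fun r hr => (hasDerivAt_tentE_sqrt hp hr.1).differentiableAt.differentiableWithinAt
  · intro r hr
    rw [(hasDerivAt_tentE_sqrt hp hr.1).deriv]
    exact tentV_le hp hp1 (Real.sqrt_pos.mpr hr.1)

end Slope

section KernelIntegral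

variable {p x t : ℝ}

lemma integrableOn_ker (hp : -1 < p) (hp1 : p < 1) (hx : 0 < x) :
    IntegrableOn (ker p x) (Ioi 0) := by
  have i0 : IntegrableOn (ker p x) (Ioc 0 x) :=
    (intervalIntegrable_iff_integrableOn_Ioc_of_le hx.le).mp (intervalIntegrable_ker hp x 0 x)
  rw [← Ioc_union_Ioi_eq_Ioi hx.le]
  refine i0.union ?_
  have hi : ∀ t a b : ℝ, IntervalIntegrable (fun ξ => (1 - ξ ^ 2 / t ^ 2) * ker p x ξ)
      volume a b := fun t a b =>
    (intervalIntegrable_ker hp x a b).continuousOn_mul (by fun_prop)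
  refine integrableOn_Ioi_of_intervalIntegral_norm_bounded
    (4 / 3 * ∫ ξ in (0:ℝ)..x, ‖ker p x ξ‖) x (b := id) (l := atTop)
    (fun t => (intervalIntegrable_ker hp x x t).1) tendsto_id ?_
  filter_upwards [eventually_ge_atTop x] with t hxt
  have ht : 0 < t := by linarith
  have h1 : ∫ ξ in x..t, ‖ker p x ξ‖
      ≤ 4 / 3 * ∫ ξ in x..t, (1 - ξ ^ 2 / (2 * t) ^ 2) * ker p x ξ := by
    rw [← intervalIntegral.integral_const_mul]
    refine intervalIntegral.integral_mono_on_of_le_Ioo hxt (intervalIntegrable_ker hp x x t).norm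
      ((hi _ _ _).const_mul _) fun ξ hξ => ?_
    have hK := ker_nonneg hp1 hx hξ.1
    have h2 : ξ ^ 2 / (2 * t) ^ 2 ≤ 1 / 4 := by
      rw [div_le_iff₀ (by positivity)]
      nlinarith [hξ.1, hξ.2]
    rw [Real.norm_of_nonneg hK]
    nlinarith
  have h2 : ∫ ξ in x..t, (1 - ξ ^ 2 / (2 * t) ^ 2) * ker p x ξ
      ≤ ∫ ξ in x..(2 * t), (1 - ξ ^ 2 / (2 * t) ^ 2) * ker p x ξ := by
    rw [← intervalIntegral.integral_add_adjacent_intervals (hi _ x t) (hi _ t (2 * t)),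
      le_add_iff_nonneg_right]
    refine intervalIntegral.integral_nonneg_of_ae_restrict (by linarith) ?_
    rw [EventuallyLE, ae_restrict_iff' measurableSet_Icc]
    filter_upwards [compl_mem_ae_iff.mpr (measure_singleton t)] with ξ hξ hξ'
    have h3 : t < ξ := lt_of_le_of_ne hξ'.1 (Ne.symm hξ)
    refine mul_nonneg ?_ (ker_nonneg hp1 hx (by linarith))
    rw [sub_nonneg, div_le_one (by positivity)]
    exact pow_le_pow_left₀ (by linarith) hξ'.2 2
  have h3 := intervalIntegral.integral_add_adjacent_intervals (hi (2 * t) 0 x) (hi _ x (2 * t))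
  rw [integral_tent_mul_ker hp hx (by positivity)] at h3
  have h4 : 0 ≤ (2 * t) ^ (p + 1) * tentE p (x / (2 * t)) :=
    mul_nonneg (by positivity) (tentE_nonneg hp hp1 (by positivity))
  have h5 : -(∫ ξ in (0:ℝ)..x, (1 - ξ ^ 2 / (2 * t) ^ 2) * ker p x ξ)
      ≤ ∫ ξ in (0:ℝ)..x, ‖ker p x ξ‖ := by
    rw [← intervalIntegral.integral_neg]
    refine intervalIntegral.integral_mono_on hx.le (hi _ _ _).neg
      (intervalIntegrable_ker hp x 0 x).norm fun ξ hξ => ?_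
    refine (neg_le_abs _).trans ?_
    rw [abs_mul, Real.norm_eq_abs]
    refine mul_le_of_le_one_left (abs_nonneg _) (abs_le.mpr ⟨?_, ?_⟩)
    · have : ξ ^ 2 / (2 * t) ^ 2 ≤ 1 := by
        rw [div_le_one (by positivity)]
        exact pow_le_pow_left₀ hξ.1 (by linarith [hξ.2]) 2
      linarith
    · have : 0 ≤ ξ ^ 2 / (2 * t) ^ 2 := by positivity
      linarith
  simp only [id]
  linarith

lemma integral_max_mul_ker (hp : -1 < p) (hx : 0 < x) (ht : 0 < t) :
    ∫ ξ in Ioi (0:ℝ), max 0 (1 - ξ ^ 2 / t ^ 2) * ker p x ξ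
      = -(t ^ (p + 1) * tentE p (x / t)) := by
  rw [← integral_tent_mul_ker hp hx ht, intervalIntegral.integral_of_le ht.le,
    setIntegral_eq_of_subset_of_forall_sdiff_eq_zero measurableSet_Ioi
      (Ioc_subset_Ioi_self : Ioc 0 t ⊆ Ioi 0)]
  · refine setIntegral_congr_fun measurableSet_Ioc fun ξ hξ => ?_
    have : ξ ^ 2 / t ^ 2 ≤ 1 := by
      rw [div_le_one (by positivity)]
      exact pow_le_pow_left₀ hξ.1.le hξ.2 2
    simp only [max_eq_right (sub_nonneg.mpr this)]
  · rintro ξ ⟨h1, h2⟩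
    have h3 : t < ξ := by
      by_contra h
      exact h2 ⟨h1, not_lt.mp h⟩
    have : 1 ≤ ξ ^ 2 / t ^ 2 := by
      rw [one_le_div (by positivity)]
      exact pow_le_pow_left₀ ht.le h3.le 2
    rw [max_eq_left (by linarith), zero_mul]

lemma integral_ker (hp : -1 < p) (hp1 : p < 1) (hx : 0 < x) :
    ∫ ξ in Ioi (0:ℝ), ker p x ξ = 0 := by
  have hK := integrableOn_ker hp hp1 hx
  have h1 : Tendsto (fun t : ℝ => ∫ ξ in Ioi (0:ℝ), max 0 (1 - ξ ^ 2 / t ^ 2) * ker p x ξ) atTop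
      (nhds (∫ ξ in Ioi (0:ℝ), ker p x ξ)) := by
    refine tendsto_integral_filter_of_dominated_convergence (fun ξ => ‖ker p x ξ‖) ?_ ?_
      hK.norm ?_
    · exact Eventually.of_forall fun t =>
        (Continuous.aestronglyMeasurable (by fun_prop)).mul hK.aestronglyMeasurable
    · refine Eventually.of_forall fun t => Eventually.of_forall fun ξ => ?_
      rw [norm_mul]
      refine mul_le_of_le_one_left (norm_nonneg _) ?_
      rw [Real.norm_of_nonneg (le_max_left _ _)]
      have : 0 ≤ ξ ^ 2 / t ^ 2 := by positivity
      exact max_le zero_le_one (by linarith)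
    · refine Eventually.of_forall fun ξ => ?_
      have h : Tendsto (fun t : ℝ => ξ ^ 2 / t ^ 2) atTop (nhds 0) :=
        tendsto_const_nhds.div_atTop (tendsto_pow_atTop two_ne_zero)
      have := (tendsto_const_nhds (x := (0:ℝ))).max (h.const_sub 1)
      simpa using this.mul_const (ker p x ξ)
  have h2 : Tendsto (fun t : ℝ => -(t ^ (p + 1) * tentE p (x / t))) atTop (nhds 0) := by
    rw [← neg_zero]
    refine Tendsto.neg ?_
    have h3 : Tendsto (fun t : ℝ => tentA p * x ^ 2 * t ^ (-(1 - p))) atTop (nhds 0) := by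
      simpa using (tendsto_rpow_neg_atTop (show 0 < 1 - p by linarith)).const_mul
        (tentA p * x ^ 2)
    refine squeeze_zero' ?_ ?_ h3
    · filter_upwards [eventually_gt_atTop 0] with t ht
      exact mul_nonneg (by positivity) (tentE_nonneg hp hp1 (by positivity))
    · filter_upwards [eventually_gt_atTop 0] with t ht
      calc t ^ (p + 1) * tentE p (x / t) ≤ t ^ (p + 1) * (tentA p * (x / t) ^ 2) := by
            gcongr
            exact tentE_le hp hp1 (by positivity)
        _ = _ := by
          rw [show p + 1 = -(1 - p) + 1 + 1 by ring, Real.rpow_add_one ht.ne',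
            Real.rpow_add_one ht.ne']
          field_simp
  refine tendsto_nhds_unique h1 (h2.congr' ?_)
  filter_upwards [eventually_gt_atTop 0] with t ht
  rw [integral_max_mul_ker hp hx ht]

lemma integrableOn_min_mul_ker (hp : -1 < p) (hp1 : p < 1) (hx : 0 < x) (s : ℝ) :
    IntegrableOn (fun ξ => min (ξ ^ 2) s * ker p x ξ) (Ioi 0) := by
  refine (integrableOn_ker hp hp1 hx).bdd_mul (c := |s|)
    (Continuous.aestronglyMeasurable (by fun_prop)) (Eventually.of_forall fun ξ => ?_)
  rw [Real.norm_eq_abs, abs_le]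
  refine ⟨le_min ?_ (neg_abs_le s), (min_le_right _ _).trans (le_abs_self s)⟩
  nlinarith [abs_nonneg s, sq_nonneg ξ]

lemma integral_min_mul_ker (hp : -1 < p) (hp1 : p < 1) (hx : 0 < x) (ht : 0 < t) :
    ∫ ξ in Ioi (0:ℝ), min (ξ ^ 2) (t ^ 2) * ker p x ξ
      = t ^ 2 * (t ^ (p + 1) * tentE p (x / t)) := by
  have e : ∀ ξ, t ^ 2 * (max 0 (1 - ξ ^ 2 / t ^ 2) * ker p x ξ)
      = t ^ 2 * ker p x ξ - min (ξ ^ 2) (t ^ 2) * ker p x ξ := by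
    intro ξ
    rw [← mul_assoc, mul_max_of_nonneg _ _ (sq_nonneg t), ← sub_mul]
    congr 1
    rw [mul_zero, mul_sub, mul_div_cancel₀ _ (by positivity), mul_one]
    rcases le_total (ξ ^ 2) (t ^ 2) with h | h
    · rw [min_eq_left h, max_eq_right (by linarith)]
    · rw [min_eq_right h, max_eq_left (by linarith), sub_self]
  have h := integral_max_mul_ker hp hx ht
  have h2 : ∫ ξ in Ioi (0:ℝ), t ^ 2 * (max 0 (1 - ξ ^ 2 / t ^ 2) * ker p x ξ) =
      - ∫ ξ in Ioi (0:ℝ), min (ξ ^ 2) (t ^ 2) * ker p x ξ := by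
    simp only [e]
    rw [integral_sub ((integrableOn_ker hp hp1 hx).const_mul _)
      (integrableOn_min_mul_ker hp hp1 hx _), integral_const_mul, integral_ker hp hp1 hx]
    ring
  rw [integral_const_mul, h] at h2
  linarith

lemma integrableOn_min_mul_rpow (hp : -1 < p) (hp1 : p < 1) (ht : 0 < t) :
    IntegrableOn (fun ξ => min (ξ ^ 2) (t ^ 2) * ξ ^ (p - 2)) (Ioi 0) ∧
    ∫ ξ in Ioi (0:ℝ), min (ξ ^ 2) (t ^ 2) * ξ ^ (p - 2)
      = 2 / ((1 - p) * (1 + p)) * t ^ (p + 1) := by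
  have h1 : p + 1 ≠ 0 := by linarith
  have h2 : p - 2 + 1 ≠ 0 := by linarith
  have h3 : 1 - p ≠ 0 := by linarith
  have h4 : 1 + p ≠ 0 := by linarith
  have e1 : EqOn (fun ξ => min (ξ ^ 2) (t ^ 2) * ξ ^ (p - 2)) (fun ξ : ℝ => ξ ^ p) (Ioc 0 t) := by
    intro ξ hξ
    simp only
    rw [min_eq_left (pow_le_pow_left₀ hξ.1.le hξ.2 2), ← Real.rpow_two, ← Real.rpow_add hξ.1]
    congr 1
    ring
  have e2 : EqOn (fun ξ => min (ξ ^ 2) (t ^ 2) * ξ ^ (p - 2)) (fun ξ : ℝ => t ^ 2 * ξ ^ (p - 2))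
      (Ioi t) := by
    intro ξ hξ
    simp only
    rw [min_eq_right (pow_le_pow_left₀ ht.le (le_of_lt hξ) 2)]
  have i1 : IntegrableOn (fun ξ : ℝ => ξ ^ p) (Ioc 0 t) :=
    (intervalIntegrable_iff_integrableOn_Ioc_of_le ht.le).mp
      (intervalIntegral.intervalIntegrable_rpow' hp)
  have i2 : IntegrableOn (fun ξ : ℝ => t ^ 2 * ξ ^ (p - 2)) (Ioi t) :=
    (integrableOn_Ioi_rpow_of_lt (by linarith) ht).const_mul _
  have j1 := i1.congr_fun e1.symm measurableSet_Ioc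
  have j2 := i2.congr_fun e2.symm measurableSet_Ioi
  rw [← Ioc_union_Ioi_eq_Ioi ht.le]
  refine ⟨j1.union j2, ?_⟩
  rw [setIntegral_union (Ioc_disjoint_Ioi le_rfl) measurableSet_Ioi j1 j2,
    setIntegral_congr_fun measurableSet_Ioc e1, setIntegral_congr_fun measurableSet_Ioi e2,
    integral_const_mul, integral_Ioi_rpow_of_lt (by linarith) ht,
    ← intervalIntegral.integral_of_le ht.le, integral_rpow (Or.inl hp), Real.zero_rpow h1,
    show p + 1 = (p - 2 + 1) + 1 + 1 by ring, Real.rpow_add_one ht.ne', Real.rpow_add_one ht.ne']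
  have h5 : p - 2 + 1 + 1 + 1 ≠ 0 := fun h => h1 (by linarith)
  field_simp
  ring

end KernelIntegral

section SlopeBound

variable {p t η : ℝ}

lemma tentA_pos (hp : -1 < p) (hp1 : p < 1) : 0 < tentA p := by
  unfold tentA
  have : 0 < 2 - p := by linarith
  have : 0 < p + 1 := by linarith
  positivity

lemma mul_rpow_le_of_young (hp : -1 < p) (hp1 : p < 1) (hη : 0 < η) {ω : ℝ} (hω : 0 < ω) :
    η * ω ^ (p + 1) ≤ (p + 1) / 5 * ω ^ 5
      + (1 - (p + 1) / 5) * (η ^ ((p + 1) / (4 - p)) * η) := by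
  have h4 : 4 - p ≠ 0 := by linarith
  have h := Real.geom_mean_le_arith_mean2_weighted (w₁ := (p + 1) / 5) (w₂ := 1 - (p + 1) / 5)
    (p₁ := ω ^ 5) (p₂ := η ^ ((p + 1) / (4 - p)) * η) (by linarith) (by linarith)
    (by positivity) (by positivity) (by ring)
  refine le_trans (le_of_eq ?_) h
  rw [← Real.rpow_add_one hη.ne', ← Real.rpow_natCast, ← Real.rpow_mul hω.le,
    ← Real.rpow_mul hη.le, mul_comm]
  have e1 : ((5:ℕ):ℝ) * ((p + 1) / 5) = p + 1 := by push_cast; ring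
  have e2 : ((p + 1) / (4 - p) + 1) * (1 - (p + 1) / 5) = 1 := by field_simp; ring
  rw [e1, e2, Real.rpow_one]

lemma slope_term_lower (hp : -1 < p) (hp1 : p < 1) (hη : 0 < η)
    (h : (1 - (p + 1) / 5) * η ^ ((p + 1) / (4 - p)) + η ≤ tentV p 1 / tentA p)
    {ω : ℝ} (hω : 0 < ω) :
    tentA p * ((if 1 ≤ ω then tentV p 1 / tentA p - η else 0)
      - (if 1 ≤ ω then 0 else (1 - (p + 1) / 5) * (η ^ ((p + 1) / (4 - p)) * η)))
      ≤ ω ^ (p + 1) * (tentV p (1 / ω) - η * tentA p) := by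
  have ha := tentA_pos hp hp1
  have hX : 0 < (1 - (p + 1) / 5) * η ^ ((p + 1) / (4 - p)) :=
    mul_pos (by linarith) (by positivity)
  split_ifs with h1
  · have hV : tentV p 1 ≤ tentV p (1 / ω) := tentV_antitoneOn hp hp1
      (show (0:ℝ) < 1 / ω by positivity) (show (0:ℝ) < 1 by norm_num)
      ((div_le_one hω).mpr h1)
    have hω1 : 1 ≤ ω ^ (p + 1) := Real.one_le_rpow h1 (by linarith)
    have h2 : 0 ≤ tentV p 1 - η * tentA p := by
      have : η ≤ tentV p 1 / tentA p := by linarith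
      rw [le_div_iff₀ ha] at this
      linarith
    have h3 : tentA p * (tentV p 1 / tentA p - η - 0) = tentV p 1 - η * tentA p := by
      field_simp
      ring
    rw [h3]
    nlinarith
  · have h1' : 1 < 1 / ω := (one_lt_div hω).mpr (not_le.mp h1)
    have hV := tentV_lower hp hp1 h1'
    have hY := mul_rpow_le_of_young hp hp1 hη hω
    have e : ω ^ (p + 1) * (2 / 15 * (2 - p) * (1 / ω) ^ (p - 4))
        = tentA p * ((p + 1) / 5 * ω ^ 5) := by
      have : p + 1 ≠ 0 := by linarith
      rw [one_div, Real.inv_rpow hω.le, ← Real.rpow_neg hω.le, ← Real.rpow_natCast ω 5,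
        mul_left_comm, ← Real.rpow_add hω]
      rw [show p + 1 + -(p - 4) = ((5:ℕ):ℝ) by push_cast; ring, tentA]
      field_simp
      ring
    calc _ ≤ tentA p * ((p + 1) / 5 * ω ^ 5 - η * ω ^ (p + 1)) := by
          refine mul_le_mul_of_nonneg_left ?_ ha.le
          linarith
      _ = ω ^ (p + 1) * (2 / 15 * (2 - p) * (1 / ω) ^ (p - 4) - η * tentA p) := by
          rw [mul_sub, mul_sub, e]
          ring
      _ ≤ _ := by gcongr

/-- The slope bound for a superposition of tents with weights `ν` and widths `t`. -/
lemma slope_sum_lower {ι : Type*} (S : Finset ι) (ν τ : ι → ℝ)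
    (hp : -1 < p) (hp1 : p < 1) (hη : 0 < η)
    (h : (1 - (p + 1) / 5) * η ^ ((p + 1) / (4 - p)) + η ≤ tentV p 1 / tentA p)
    (hν : ∀ i ∈ S, 0 ≤ ν i) (hτ : ∀ i ∈ S, 0 < τ i) (hν1 : ∑ i ∈ S, ν i ≤ 1)
    (hνη : η ≤ ∑ i ∈ S, if 1 ≤ 2 * τ i then ν i else 0) :
    η * (tentA p * ∑ i ∈ S, ν i * τ i ^ (p + 1))
      ≤ ∑ i ∈ S, ν i * (τ i ^ (p + 1) * tentV p (1 / (2 * τ i))) := by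
  set X := (1 - (p + 1) / 5) * (η ^ ((p + 1) / (4 - p)) * η) with hX
  set r := tentV p 1 / tentA p with hr
  have ha := tentA_pos hp hp1
  have hX0 : 0 ≤ X := mul_nonneg (by linarith) (by positivity)
  have hrη : 0 ≤ r - η := by
    have : 0 ≤ (1 - (p + 1) / 5) * η ^ ((p + 1) / (4 - p)) :=
      mul_nonneg (by linarith) (by positivity)
    linarith
  have h1 : ∑ i ∈ S, ν i * (tentA p * ((if 1 ≤ 2 * τ i then r - η else 0)
      - (if 1 ≤ 2 * τ i then 0 else X)))
      ≤ ∑ i ∈ S, ν i * ((2 * τ i) ^ (p + 1) * (tentV p (1 / (2 * τ i)) - η * tentA p)) :=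
    Finset.sum_le_sum fun i hi => mul_le_mul_of_nonneg_left
      (slope_term_lower hp hp1 hη h (by linarith [hτ i hi])) (hν i hi)
  have h2 : tentA p * ((r - η) * (∑ i ∈ S, if 1 ≤ 2 * τ i then ν i else 0) - X * ∑ i ∈ S, ν i)
      ≤ ∑ i ∈ S, ν i * (tentA p * ((if 1 ≤ 2 * τ i then r - η else 0)
      - (if 1 ≤ 2 * τ i then 0 else X))) := by
    rw [Finset.mul_sum, Finset.mul_sum, ← Finset.sum_sub_distrib, Finset.mul_sum]
    refine Finset.sum_le_sum fun i hi => ?_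
    have := hν i hi
    rw [mul_left_comm]
    refine mul_le_mul_of_nonneg_left ?_ ha.le
    split_ifs <;> nlinarith
  have h3 : 0 ≤ (r - η) * (∑ i ∈ S, if 1 ≤ 2 * τ i then ν i else 0) - X * ∑ i ∈ S, ν i := by
    have h4 : X ≤ (r - η) * η := by
      rw [hX, ← mul_assoc]
      exact mul_le_mul_of_nonneg_right (by linarith) hη.le
    nlinarith
  have h5 : ∑ i ∈ S, ν i * ((2 * τ i) ^ (p + 1) * (tentV p (1 / (2 * τ i)) - η * tentA p))
      = 2 ^ (p + 1) * (∑ i ∈ S, ν i * (τ i ^ (p + 1) * tentV p (1 / (2 * τ i)))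
        - η * (tentA p * ∑ i ∈ S, ν i * τ i ^ (p + 1))) := by
    rw [Finset.mul_sum, Finset.mul_sum, ← Finset.sum_sub_distrib, Finset.mul_sum]
    refine Finset.sum_congr rfl fun i hi => ?_
    rw [Real.mul_rpow zero_le_two (hτ i hi).le]
    ring
  rw [h5] at h1
  have h6 := (mul_nonneg ha.le h3).trans (h2.trans h1)
  have h7 := nonneg_of_mul_nonneg_right h6 (by positivity)
  linarith

end SlopeBound

section Eta

variable {α : ℝ}

/-- The base of the power defining `etaC`. -/
def etaBase (α : ℝ) : ℝ := 3 / (2 * (3 - 2 * α) * (5 - 2 * α) * (1 + (4:ℝ) ^ α))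

lemma four_rpow_lower (hα : 0 < α) (hα1 : α < 1) :
    15 ≤ (3 - 2 * α) * (5 - 2 * α) * (1 + (4:ℝ) ^ α) := by
  have h1 : (1:ℝ) ≤ 4 ^ α := Real.one_le_rpow (by norm_num) hα.le
  rcases le_total α (1 / 2) with h | h
  · nlinarith [mul_nonneg (show 0 ≤ 1 / 2 - α by linarith) (show 0 ≤ 5 / 2 - α by linarith)]
  · have h2 : 1 + 2 * 0.6931471808 * (α - 1) ≤ (4:ℝ) ^ (α - 1) := by
      have h3 := Real.add_one_le_exp (Real.log 4 * (α - 1))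
      rw [← Real.rpow_def_of_pos (by norm_num)] at h3
      have h4 : Real.log 4 = 2 * Real.log 2 := by
        rw [show (4:ℝ) = 2 ^ 2 by norm_num, Real.log_pow]
        norm_num
      rw [h4] at h3
      nlinarith [Real.log_two_lt_d9]
    rw [Real.rpow_sub_one (by norm_num)] at h2
    have h5 : 5 - 2 * 2.7725887232 * (1 - α) ≤ 1 + (4:ℝ) ^ α := by linarith
    have h6 : 0 < (3 - 2 * α) * (5 - 2 * α) := mul_pos (by linarith) (by linarith)
    refine le_trans ?_ (mul_le_mul_of_nonneg_left h5 h6.le)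
    obtain ⟨β, rfl⟩ : ∃ β, α = 1 - β := ⟨1 - α, by ring⟩
    have hβ : 0 < β := by linarith
    have hβ2 : β ≤ 1 / 2 := by linarith
    have : 0 ≤ β * (1 / 2 - β) := mul_nonneg hβ.le (by linarith)
    have : 0 ≤ β * β * (1 / 2 - β) := mul_nonneg (by positivity) (by linarith)
    nlinarith

lemma etaBase_pos (hα : 0 < α) (hα1 : α < 1) : 0 < etaBase α := by
  have := four_rpow_lower hα hα1
  unfold etaBase
  rw [mul_assoc, mul_assoc, ← mul_assoc (3 - 2 * α)]
  positivity

lemma etaBase_le (hα : 0 < α) (hα1 : α < 1) : etaBase α ≤ 1 / 10 := by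
  have := four_rpow_lower hα hα1
  unfold etaBase
  rw [mul_assoc, mul_assoc, ← mul_assoc (3 - 2 * α), div_le_div_iff₀ (by positivity) (by norm_num)]
  linarith

lemma etaC_pos (hα : 0 < α) (hα1 : α < 1) : 0 < etaC α :=
  mul_pos two_pos (Real.rpow_pos_of_pos (etaBase_pos hα hα1) _)

lemma etaC_le (hα : 0 < α) (hα1 : α < 1) : etaC α ≤ 1 / 50 := by
  have hB := etaBase_pos hα hα1
  have hB1 := etaBase_le hα hα1
  have hm : 0 < min α (1 - α) := lt_min hα (by linarith)
  have h1 : etaBase α ^ (1 / min α (1 - α)) ≤ etaBase α ^ (2:ℝ) := by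
    refine Real.rpow_le_rpow_of_exponent_ge hB (by linarith) ?_
    rw [le_div_iff₀ hm]
    linarith [min_le_left α (1 - α), min_le_right α (1 - α)]
  rw [Real.rpow_two] at h1
  have : etaC α = 2 * etaBase α ^ (1 / min α (1 - α)) := rfl
  nlinarith

lemma etaC_rpow_le (hα : 0 < α) (hα1 : α < 1) : etaC α ^ (2 - 2 * α) ≤ 2 ^ (2 - 2 * α) / 100 := by
  have hB := etaBase_pos hα hα1
  have hB1 := etaBase_le hα hα1
  have hm : 0 < min α (1 - α) := lt_min hα (by linarith)
  have h2 : 0 < 2 - 2 * α := by linarith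
  have : etaC α = 2 * etaBase α ^ (1 / min α (1 - α)) := rfl
  rw [this, Real.mul_rpow zero_le_two (by positivity), ← Real.rpow_mul hB.le, div_eq_mul_inv]
  have h1 : etaBase α ^ (1 / min α (1 - α) * (2 - 2 * α)) ≤ etaBase α ^ (2:ℝ) := by
    refine Real.rpow_le_rpow_of_exponent_ge hB (by linarith) ?_
    rw [div_mul_eq_mul_div, le_div_iff₀ hm]
    linarith [min_le_right α (1 - α)]
  rw [Real.rpow_two] at h1
  exact mul_le_mul_of_nonneg_left (h1.trans (by nlinarith)) (by positivity)

lemma etaC_slope_condition (hα : 0 < α) (hα1 : α < 1) {p : ℝ} (hp : p = 1 - 2 * α) :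
    (1 - (p + 1) / 5) * etaC α ^ ((p + 1) / (4 - p)) + etaC α ≤ tentV p 1 / tentA p := by
  have hη := etaC_pos hα hα1
  have hη1 := etaC_le hα hα1
  have hη2 := etaC_rpow_le hα hα1
  obtain ⟨q, rfl⟩ : ∃ q, p = q - 1 := ⟨p + 1, by ring⟩
  obtain rfl : α = 1 - q / 2 := by linarith
  have hq : 0 < q := by linarith
  have hq2 : q < 2 := by linarith
  rw [show 2 - 2 * (1 - q / 2) = q by ring] at hη2
  set η := etaC (1 - q / 2)
  have hX : η ^ ((q - 1 + 1) / (4 - (q - 1))) ≤ 2 / 5 := by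
    have h5 : 0 < 5 - q := by linarith
    have e : (q - 1 + 1) / (4 - (q - 1)) = q * (5 - q)⁻¹ := by rw [div_eq_mul_inv]; ring_nf
    rw [e, Real.rpow_mul hη.le, ← Real.rpow_rpow_inv (show (0:ℝ) ≤ 2 / 5 by norm_num) h5.ne']
    refine Real.rpow_le_rpow (by positivity) (hη2.trans ?_) (by positivity)
    rw [Real.rpow_sub (by norm_num), le_div_iff₀ (by positivity), div_mul_eq_mul_div,
      ← Real.mul_rpow zero_le_two (by norm_num), show (5:ℝ) = ((5:ℕ):ℝ) by norm_num,
      Real.rpow_natCast]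
    have h3 : ((2:ℝ) * (2 / (5:ℕ))) ^ q ≤ 1 :=
      Real.rpow_le_one (by norm_num) (by norm_num) hq.le
    exact (div_le_div_of_nonneg_right h3 (by norm_num)).trans (by norm_num)
  have h2q : 1 + 0.693 * q + 0.24 * q ^ 2 ≤ (2:ℝ) ^ q := by
    have h1 := Real.log_two_gt_d9
    have h3 := Real.quadratic_le_exp_of_nonneg (show 0 ≤ Real.log 2 * q by positivity)
    rw [← Real.rpow_def_of_pos two_pos] at h3
    have h4 : 0.48 ≤ Real.log 2 ^ 2 := by nlinarith
    nlinarith [mul_nonneg (sub_nonneg.mpr h4) (sq_nonneg q)]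
  have e : tentV (q - 1) 1 / tentA (q - 1) = 3 / 2 * 2 ^ q / ((q + 1) * (q + 3)) := by
    have h3 : 3 - q ≠ 0 := by linarith
    have h1 : q + 1 ≠ 0 := by linarith
    have h4 : q + 3 ≠ 0 := by linarith
    have h6 : 2 - (q - 1) ≠ 0 := fun h => h3 (by linarith)
    rw [tentV_one (by linarith), tentA, show q - 1 + 2 = q + 1 by ring,
      show q - 1 + 4 = q + 3 by ring, sub_add_cancel, Real.rpow_add_one two_ne_zero]
    field_simp
  rw [e, le_div_iff₀ (by positivity)]
  have h1 : (1 - (q - 1 + 1) / 5) * η ^ ((q - 1 + 1) / (4 - (q - 1))) + η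
      ≤ (1 - q / 5) * (2 / 5) + 1 / 50 := by
    rw [sub_add_cancel] at hX ⊢
    have : 0 ≤ 1 - q / 5 := by linarith
    gcongr
  refine (mul_le_mul_of_nonneg_right h1 (by positivity)).trans ?_
  nlinarith [sq_nonneg (q - 0.77), mul_pos (mul_pos hq hq) hq]

end Eta

section Approximation

variable {F : ℝ → ℝ} {δ η : ℝ} {M : ℕ}

/-- Decrease rate of `F` on `[iδ, (i+1)δ]` for `i < M`, and `0` for `i ≥ M`. -/
def decRate (F : ℝ → ℝ) (δ : ℝ) (M i : ℕ) : ℝ :=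
  if i < M then (F (i * δ) - F ((i + 1 : ℕ) * δ)) / δ else 0

lemma decRate_nonneg (hF : AntitoneOn F (Ici 0)) (hδ : 0 < δ) (i : ℕ) : 0 ≤ decRate F δ M i := by
  unfold decRate
  split_ifs
  · refine div_nonneg (sub_nonneg.mpr (hF ?_ ?_ ?_)) hδ.le
    · exact (by positivity : (0:ℝ) ≤ i * δ)
    · exact (by positivity : (0:ℝ) ≤ (i + 1 : ℕ) * δ)
    · gcongr
      exact Nat.le_succ i
  · exact le_rfl

lemma decRate_succ_le (hc : ConvexOn ℝ (Ici 0) F) (hF : AntitoneOn F (Ici 0)) (hδ : 0 < δ)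
    (i : ℕ) : decRate F δ M (i + 1) ≤ decRate F δ M i := by
  by_cases h : i + 1 < M
  · have h' : i < M := by omega
    unfold decRate
    rw [if_pos h, if_pos h']
    gcongr ?_ / δ
    have h1 := hc.2 (show (0:ℝ) ≤ i * δ by positivity)
      (show (0:ℝ) ≤ (i + 1 + 1 : ℕ) * δ by positivity)
      (show (0:ℝ) ≤ 1 / 2 by norm_num) (show (0:ℝ) ≤ 1 / 2 by norm_num) (by norm_num)
    simp only [smul_eq_mul] at h1
    rw [show 1 / 2 * (i * δ) + 1 / 2 * ((i + 1 + 1 : ℕ) * δ) = (i + 1 : ℕ) * δ by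
      push_cast; ring] at h1
    linarith
  · have : decRate F δ M (i + 1) = 0 := if_neg h
    rw [this]
    exact decRate_nonneg hF hδ i

lemma sum_range_decRate_mul_min {s : ℝ} (hs : 0 ≤ s) :
    ∑ i ∈ Finset.range M, (decRate F δ M i - decRate F δ M (i + 1)) * min s ((i + 1 : ℕ) * δ)
      = ∑ i ∈ Finset.range M, decRate F δ M i * (min s ((i + 1 : ℕ) * δ) - min s (i * δ)) := by
  have key : ∀ (D g : ℕ → ℝ) (m : ℕ), ∑ i ∈ Finset.range m, (D i - D (i + 1)) * g (i + 1)
      = ∑ i ∈ Finset.range m, D i * (g (i + 1) - g i) - D m * g m + D 0 * g 0 := by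
    intro D g m
    induction m with
    | zero => simp
    | succ m ih =>
      rw [Finset.sum_range_succ, ih, Finset.sum_range_succ]
      ring
  have hM : decRate F δ M M = 0 := if_neg (lt_irrefl M)
  rw [key (decRate F δ M) (fun i => min s (i * δ)), hM]
  simp [hs]

/-- The superposition of tents interpolates `1 - F` on the grid. -/
lemma sum_range_decRate_mul_min_grid (hδ : 0 < δ) {k : ℕ} (hk : k ≤ M) :
    ∑ i ∈ Finset.range M, (decRate F δ M i - decRate F δ M (i + 1))
      * min (k * δ) ((i + 1 : ℕ) * δ) = F 0 - F (k * δ) := by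
  rw [sum_range_decRate_mul_min (by positivity)]
  have h1 : ∀ i ∈ Finset.range M, decRate F δ M i * (min (k * δ) ((i + 1 : ℕ) * δ)
      - min (k * δ) (i * δ)) = if i < k then F (i * δ) - F ((i + 1 : ℕ) * δ) else 0 := by
    intro i hi
    rw [decRate, if_pos (Finset.mem_range.mp hi), ← min_mul_of_nonneg _ _ hδ.le,
      ← min_mul_of_nonneg _ _ hδ.le]
    split_ifs with h
    · rw [min_eq_right (by exact_mod_cast h), min_eq_right (by exact_mod_cast h.le)]
      push_cast
      field_simp
      ring
    · have h' : k ≤ i := not_lt.mp h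
      rw [min_eq_left (by exact_mod_cast h'.trans (Nat.le_succ i)),
        min_eq_left (by exact_mod_cast h'), sub_self, mul_zero]
  rw [Finset.sum_congr rfl h1, ← Finset.sum_filter,
    show (Finset.range M).filter (· < k) = Finset.range k by ext i; simp; omega]
  have := Finset.sum_range_sub' (fun i : ℕ => F (i * δ)) k
  simpa using this

lemma sum_range_ite_decRate {n : ℕ} (hn : n ≤ M) :
    ∑ i ∈ Finset.range M, (if n ≤ i then decRate F δ M i - decRate F δ M (i + 1) else 0)
      = decRate F δ M n := by
  have key : ∀ (D : ℕ → ℝ) (m : ℕ), n ≤ m →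
      ∑ i ∈ Finset.range m, (if n ≤ i then D i - D (i + 1) else 0) = D n - D m := by
    intro D m hm
    induction m, hm using Nat.le_induction with
    | base =>
      rw [sub_self]
      exact Finset.sum_eq_zero fun i hi => if_neg (not_le.mpr (Finset.mem_range.mp hi))
    | succ m hm ih =>
      rw [Finset.sum_range_succ, ih, if_pos hm]
      ring
  rw [key _ _ hn, show decRate F δ M M = 0 from if_neg (lt_irrefl M), sub_zero]

/-- Approximation of a convex profile by superpositions of tents in the variable `x²`. -/
lemma exists_tent_approximation (hc : ConvexOn ℝ (Ici 0) F) (hF : AntitoneOn F (Ici 0))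
    (h0 : F 0 = 1) (hpos : ∀ s, 0 ≤ s → 0 ≤ F s) (hlow : ∀ s, 0 ≤ s → 1 - s ≤ F s)
    (hη : ∀ s, 0 ≤ s → s < 1 / 4 → η * (1 / 4 - s) ≤ F s - F (1 / 4)) (n : ℕ) :
    ∃ (M : ℕ) (ν σ : ℕ → ℝ), (∀ i, 0 ≤ ν i) ∧ (∀ i, 0 < σ i) ∧
      ∑ i ∈ Finset.range M, ν i ≤ 1 ∧
      η ≤ ∑ i ∈ Finset.range M, (if 1 / 4 ≤ σ i then ν i else 0) ∧
      (∀ s : ℝ, 0 ≤ s → 0 ≤ ∑ i ∈ Finset.range M, ν i * min s (σ i) ∧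
        ∑ i ∈ Finset.range M, ν i * min s (σ i) ≤ min s 1) ∧
      ∀ s : ℝ, 0 ≤ s → s < (n + 1) / 4 →
        |∑ i ∈ Finset.range M, ν i * min s (σ i) - (1 - F s)| ≤ 1 / (4 * (n + 1)) := by
  have hn : (0:ℝ) < n + 1 := by positivity
  obtain ⟨δ, hδe⟩ : ∃ δ : ℝ, δ = 1 / (4 * (n + 1)) := ⟨_, rfl⟩
  have hδ : 0 < δ := by rw [hδe]; positivity
  have hnδ : ((n + 1 : ℕ) : ℝ) * δ = 1 / 4 := by rw [hδe]; push_cast; field_simp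
  set M := (n + 1) ^ 2 with hM
  have hMδ : (M : ℝ) * δ = (n + 1) / 4 := by rw [hδe, hM]; push_cast; field_simp
  have hnM : n < M := by rw [hM]; nlinarith
  set D := decRate F δ M with hD
  have hD0 : D 0 ≤ 1 := by
    rw [hD, decRate, if_pos (by omega), div_le_one hδ]
    have := hlow δ hδ.le
    simp [h0]
    linarith
  have hanti : Antitone D := antitone_nat_of_succ_le (decRate_succ_le hc hF hδ)
  have hν : ∀ i, 0 ≤ D i - D (i + 1) := fun i => sub_nonneg.mpr (hanti (Nat.le_succ i))
  have hσ : ∀ i : ℕ, 0 < ((i + 1 : ℕ) : ℝ) * δ := fun i => by positivity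
  have hsum : ∑ i ∈ Finset.range M, (D i - D (i + 1)) ≤ 1 := by
    rw [Finset.sum_range_sub' D M, show D M = 0 from if_neg (lt_irrefl M), sub_zero]
    exact hD0
  have hgrid : ∀ k : ℕ, k ≤ M → ∑ i ∈ Finset.range M, (D i - D (i + 1))
      * min (k * δ) ((i + 1 : ℕ) * δ) = 1 - F (k * δ) := fun k hk => by
    rw [← h0, ← sum_range_decRate_mul_min_grid hδ hk]
  have hmono : ∀ s s' : ℝ, s ≤ s' →
      ∑ i ∈ Finset.range M, (D i - D (i + 1)) * min s ((i + 1 : ℕ) * δ)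
      ≤ ∑ i ∈ Finset.range M, (D i - D (i + 1)) * min s' ((i + 1 : ℕ) * δ) := fun s s' h =>
    Finset.sum_le_sum fun i _ => mul_le_mul_of_nonneg_left (min_le_min_right _ h) (hν i)
  refine ⟨M, fun i => D i - D (i + 1), fun i => (i + 1 : ℕ) * δ, hν, hσ, hsum, ?_, ?_, ?_⟩
  · have e : ∀ i : ℕ, (1 / 4 ≤ ((i + 1 : ℕ) : ℝ) * δ) ↔ n ≤ i := by
      intro i
      rw [← hnδ, mul_le_mul_iff_left₀ hδ, Nat.cast_le]
      omega
    simp only [e]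
    rw [sum_range_ite_decRate hnM.le, decRate, if_pos hnM, le_div_iff₀ hδ, hnδ]
    have h1 : (n:ℝ) * δ = 1 / 4 - δ := by rw [← hnδ]; push_cast; ring
    have h2 := hη (n * δ) (by positivity) (by linarith)
    rw [h1] at h2 ⊢
    linarith
  · intro s hs
    refine ⟨Finset.sum_nonneg fun i _ => mul_nonneg (hν i) (le_min hs (hσ i).le),
      le_min ?_ ?_⟩
    · calc _ ≤ ∑ i ∈ Finset.range M, (D i - D (i + 1)) * s :=
          Finset.sum_le_sum fun i _ => mul_le_mul_of_nonneg_left (min_le_left _ _) (hν i)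
        _ ≤ 1 * s := by
          rw [← Finset.sum_mul]
          gcongr
        _ = s := one_mul s
    · calc _ ≤ ∑ i ∈ Finset.range M, (D i - D (i + 1)) * min (M * δ) ((i + 1 : ℕ) * δ) := by
            refine Finset.sum_le_sum fun i hi => mul_le_mul_of_nonneg_left ?_ (hν i)
            refine (min_le_right _ _).trans (le_min ?_ le_rfl)
            exact mul_le_mul_of_nonneg_right
              (Nat.cast_le.mpr (Finset.mem_range.mp hi)) hδ.le
        _ = 1 - F (M * δ) := hgrid M le_rfl
        _ ≤ 1 := by linarith [hpos (M * δ) (by positivity)]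
  · intro s hs hsM
    have hk1 : (⌊s / δ⌋₊ : ℝ) * δ ≤ s := by
      rw [← le_div_iff₀ hδ]
      exact Nat.floor_le (by positivity)
    have hk2 : s ≤ ((⌊s / δ⌋₊ + 1 : ℕ) : ℝ) * δ := by
      rw [← div_le_iff₀ hδ]
      push_cast
      exact (Nat.lt_floor_add_one _).le
    have hkM : ⌊s / δ⌋₊ < M := by
      rw [Nat.floor_lt (by positivity), div_lt_iff₀ hδ, hMδ]
      exact hsM
    generalize ⌊s / δ⌋₊ = k at *
    have g1 := hgrid k hkM.le
    have g2 := hgrid (k + 1) hkM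
    have m1 := hmono _ _ hk1
    have m2 := hmono _ _ hk2
    have f1 := hF (show (0:ℝ) ≤ k * δ by positivity) hs hk1
    have f2 := hF hs (show (0:ℝ) ≤ ((k + 1 : ℕ) : ℝ) * δ by positivity) hk2
    have f3 : F (k * δ) - F ((k + 1 : ℕ) * δ) ≤ δ := by
      have : D k ≤ 1 := (hanti (Nat.zero_le k)).trans hD0
      rwa [hD, decRate, if_pos hkM, div_le_one hδ] at this
    rw [← hδe, abs_le]
    constructor <;> linarith

end Approximation

section Superposition

variable {p η : ℝ} {ι : Type*} (S : Finset ι) (ν σ : ι → ℝ)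

/-- The (negated) image of `1 - ∑ νᵢ min(x², σᵢ)`, in the variable `s = x²`. -/
def superE (p : ℝ) (s : ℝ) : ℝ :=
  ∑ i ∈ S, ν i * (σ i * (√(σ i) ^ (p + 1) * tentE p √(s / σ i)))

/-- The slope at the origin of `superE`. -/
def superC (p : ℝ) : ℝ := tentA p * ∑ i ∈ S, ν i * √(σ i) ^ (p + 1)

variable {S ν σ}

lemma superE_concaveOn (hp : -1 < p) (hp1 : p < 1) (hν : ∀ i, 0 ≤ ν i)
    (hσ : ∀ i, 0 < σ i) : ConcaveOn ℝ (Ici 0) (superE S ν σ p) := by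
  refine ⟨convex_Ici 0, fun x hx y hy a b ha hb hab => ?_⟩
  unfold superE
  simp only [smul_eq_mul, Finset.mul_sum]
  rw [← Finset.sum_add_distrib]
  refine Finset.sum_le_sum fun i _ => ?_
  have h := (tentE_sqrt_concaveOn hp hp1).2
    (show 0 ≤ x / σ i from div_nonneg hx (hσ i).le)
    (show 0 ≤ y / σ i from div_nonneg hy (hσ i).le) ha hb hab
  simp only [smul_eq_mul] at h
  rw [show a * (x / σ i) + b * (y / σ i) = (a * x + b * y) / σ i by ring] at h
  have h2 : 0 ≤ ν i * (σ i * √(σ i) ^ (p + 1)) :=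
    mul_nonneg (hν i) (mul_nonneg (hσ i).le (by positivity))
  have := mul_le_mul_of_nonneg_left h h2
  linarith

lemma superE_monotoneOn (hp : -1 < p) (hp1 : p < 1) (hν : ∀ i, 0 ≤ ν i)
    (hσ : ∀ i, 0 < σ i) : MonotoneOn (superE S ν σ p) (Ici 0) := by
  intro x hx y hy hxy
  refine Finset.sum_le_sum fun i _ => mul_le_mul_of_nonneg_left
    (mul_le_mul_of_nonneg_left (mul_le_mul_of_nonneg_left ?_ (by positivity)) (hσ i).le) (hν i)
  exact tentE_sqrt_monotoneOn hp hp1 (div_nonneg hx (hσ i).le) (div_nonneg hy (hσ i).le)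
    (div_le_div_of_nonneg_right hxy (hσ i).le)

lemma superE_le (hp : -1 < p) (hp1 : p < 1) (hν : ∀ i, 0 ≤ ν i) (hσ : ∀ i, 0 < σ i)
    {s : ℝ} (hs : 0 ≤ s) : superE S ν σ p s ≤ superC S ν σ p * s := by
  unfold superE superC
  rw [Finset.mul_sum, Finset.sum_mul]
  refine Finset.sum_le_sum fun i _ => ?_
  have h := tentE_le hp hp1 (Real.sqrt_nonneg (s / σ i))
  rw [Real.sq_sqrt (div_nonneg hs (hσ i).le)] at h
  have h2 : 0 ≤ ν i * (σ i * √(σ i) ^ (p + 1)) :=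
    mul_nonneg (hν i) (mul_nonneg (hσ i).le (by positivity))
  have h3 := mul_le_mul_of_nonneg_left h h2
  have h4 := (hσ i).ne'
  calc _ = ν i * (σ i * √(σ i) ^ (p + 1)) * tentE p √(s / σ i) := by ring
    _ ≤ _ := h3
    _ = _ := by field_simp

lemma superE_slope (hp : -1 < p) (hp1 : p < 1) (hν : ∀ i, 0 ≤ ν i) (hσ : ∀ i, 0 < σ i)
    (hη : 0 < η)
    (h : (1 - (p + 1) / 5) * η ^ ((p + 1) / (4 - p)) + η ≤ tentV p 1 / tentA p)
    (hν1 : ∑ i ∈ S, ν i ≤ 1) (hνη : η ≤ ∑ i ∈ S, if 1 / 4 ≤ σ i then ν i else 0)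
    {s : ℝ} (hs : 0 ≤ s) (hs4 : s ≤ 1 / 4) :
    η * superC S ν σ p * (1 / 4 - s) ≤ superE S ν σ p (1 / 4) - superE S ν σ p s := by
  have e : ∀ i, (1 ≤ 2 * √(σ i)) ↔ 1 / 4 ≤ σ i := by
    intro i
    rw [show (1:ℝ) / 4 = (1 / 2) ^ 2 by norm_num, ← Real.le_sqrt' (by norm_num)]
    constructor <;> intro h <;> linarith
  have h1 := slope_sum_lower S ν (fun i => √(σ i)) hp hp1 hη h (fun i _ => hν i)
    (fun i _ => Real.sqrt_pos.mpr (hσ i)) hν1 (by simpa only [e] using hνη)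
  refine (mul_le_mul_of_nonneg_right h1 (show 0 ≤ 1 / 4 - s by linarith)).trans ?_
  unfold superE
  rw [Finset.sum_mul, ← Finset.sum_sub_distrib]
  refine Finset.sum_le_sum fun i _ => ?_
  have hi := hσ i
  have hr : 0 < √(σ i) := Real.sqrt_pos.mpr hi
  have h2 := mul_le_tentE_sqrt_sub hp (c := tentV p (1 / (2 * √(σ i))))
    (div_nonneg hs hi.le) (div_le_div_of_nonneg_right hs4 hi.le) fun r hr0 hr1 => by
      have hr0' : 0 < r := lt_of_le_of_lt (div_nonneg hs hi.le) hr0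
      refine tentV_antitoneOn hp hp1 (Real.sqrt_pos.mpr hr0')
        (show (0:ℝ) < 1 / (2 * √(σ i)) by positivity) ?_
      rw [Real.sqrt_le_left (by positivity), div_pow, mul_pow, Real.sq_sqrt hi.le]
      refine hr1.le.trans (le_of_eq ?_)
      field_simp
      norm_num
  have h3 := mul_le_mul_of_nonneg_left h2 (show 0 ≤ ν i * (σ i * √(σ i) ^ (p + 1)) from
    mul_nonneg (hν i) (by positivity))
  calc _ = ν i * (σ i * √(σ i) ^ (p + 1)) * (tentV p (1 / (2 * √(σ i)))
        * (1 / 4 / σ i - s / σ i)) := by field_simp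
    _ ≤ _ := h3
    _ = _ := by ring

lemma superC_lower (hp : -1 < p) (hp1 : p < 1) (hν : ∀ i, 0 ≤ ν i)
    (hνη : η ≤ ∑ i ∈ S, if 1 / 4 ≤ σ i then ν i else 0) :
    tentA p * (η * (1 / 2) ^ (p + 1)) ≤ superC S ν σ p := by
  refine mul_le_mul_of_nonneg_left ?_ (tentA_pos hp hp1).le
  refine (mul_le_mul_of_nonneg_right hνη (by positivity)).trans ?_
  rw [Finset.sum_mul]
  refine Finset.sum_le_sum fun i _ => ?_
  split_ifs with h
  · refine mul_le_mul_of_nonneg_left (Real.rpow_le_rpow (by norm_num) ?_ (by linarith)) (hν i)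
    rw [Real.le_sqrt' (by norm_num)]
    exact le_trans (by norm_num) h
  · rw [zero_mul]
    exact mul_nonneg (hν i) (by positivity)

lemma integral_super_mul_ker (hp : -1 < p) (hp1 : p < 1) (hσ : ∀ i, 0 < σ i)
    {s : ℝ} (hs : 0 < s) :
    ∫ ξ in Ioi (0:ℝ), (∑ i ∈ S, ν i * min (ξ ^ 2) (σ i)) * ker p √s ξ = superE S ν σ p s := by
  have hr : 0 < √s := Real.sqrt_pos.mpr hs
  simp only [Finset.sum_mul, mul_assoc]
  rw [integral_finsetSum _ fun i _ => (integrableOn_min_mul_ker hp hp1 hr (σ i)).const_mul (ν i)]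
  refine Finset.sum_congr rfl fun i _ => ?_
  have hi := hσ i
  have h := integral_min_mul_ker hp hp1 hr (Real.sqrt_pos.mpr hi)
  rw [Real.sq_sqrt hi.le, ← Real.sqrt_div hs.le] at h
  rw [integral_const_mul, h]

lemma integral_super_mul_rpow (hp : -1 < p) (hp1 : p < 1) (hσ : ∀ i, 0 < σ i) :
    tentA p * ((1 - p) * (1 + p) / 2) *
      ∫ ξ in Ioi (0:ℝ), (∑ i ∈ S, ν i * min (ξ ^ 2) (σ i)) * ξ ^ (p - 2) = superC S ν σ p := by
  have h : ∀ i, IntegrableOn (fun ξ => min (ξ ^ 2) (σ i) * ξ ^ (p - 2)) (Ioi 0) ∧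
    ∫ ξ in Ioi (0:ℝ), min (ξ ^ 2) (σ i) * ξ ^ (p - 2)
      = 2 / ((1 - p) * (1 + p)) * √(σ i) ^ (p + 1) := by
    intro i
    have := integrableOn_min_mul_rpow hp hp1 (Real.sqrt_pos.mpr (hσ i))
    rwa [Real.sq_sqrt (hσ i).le] at this
  simp only [Finset.sum_mul, mul_assoc]
  rw [integral_finsetSum _ fun i _ => (h i).1.const_mul (ν i)]
  simp only [integral_const_mul, (h _).2, superC, Finset.mul_sum]
  refine Finset.sum_congr rfl fun i _ => ?_
  have h1 : 1 - p ≠ 0 := by linarith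
  have h2 : 1 + p ≠ 0 := by linarith
  field_simp

end Superposition

section Limit

variable {p η : ℝ} {F : ℝ → ℝ}

/-- The potential of `1 - F(ξ²)` against the kernel, in the variable `s = x²`. -/
def potential (p : ℝ) (F : ℝ → ℝ) (s : ℝ) : ℝ :=
  if s = 0 then 0 else ∫ ξ in Ioi (0:ℝ), (1 - F (ξ ^ 2)) * ker p √s ξ

/-- The slope at the origin of `potential`. -/
def potentialSlope (p : ℝ) (F : ℝ → ℝ) : ℝ :=
  tentA p * ((1 - p) * (1 + p) / 2) * ∫ ξ in Ioi (0:ℝ), (1 - F (ξ ^ 2)) * ξ ^ (p - 2)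

lemma tendsto_setIntegral_mul_of_bounded {G : ℕ → ℝ → ℝ} {g b k : ℝ → ℝ}
    (hG : ∀ n, Continuous (G n)) (hk : AEStronglyMeasurable k (volume.restrict (Ioi 0)))
    (hb : IntegrableOn (fun ξ => b ξ * |k ξ|) (Ioi 0))
    (h0 : ∀ n ξ, 0 < ξ → 0 ≤ G n ξ ∧ G n ξ ≤ b ξ)
    (hlim : ∀ ξ, 0 < ξ → Tendsto (fun n => G n ξ) atTop (nhds (g ξ))) :
    Tendsto (fun n => ∫ ξ in Ioi (0:ℝ), G n ξ * k ξ) atTop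
      (nhds (∫ ξ in Ioi (0:ℝ), g ξ * k ξ)) := by
  refine tendsto_integral_of_dominated_convergence _
    (fun n => (hG n).aestronglyMeasurable.mul hk) hb (fun n => ?_) ?_
  · filter_upwards [ae_restrict_mem measurableSet_Ioi] with ξ hξ
    rw [norm_mul, Real.norm_eq_abs, Real.norm_eq_abs, abs_of_nonneg (h0 n ξ hξ).1]
    exact mul_le_mul_of_nonneg_right (h0 n ξ hξ).2 (abs_nonneg _)
  · filter_upwards [ae_restrict_mem measurableSet_Ioi] with ξ hξ
    exact (hlim ξ hξ).mul_const _

lemma exists_super_approximation (hp : -1 < p) (hp1 : p < 1)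
    (hc : ConvexOn ℝ (Ici 0) F) (hF : AntitoneOn F (Ici 0))
    (h0 : F 0 = 1) (hpos : ∀ s, 0 ≤ s → 0 ≤ F s) (hlow : ∀ s, 0 ≤ s → 1 - s ≤ F s)
    (hη : ∀ s, 0 ≤ s → s < 1 / 4 → η * (1 / 4 - s) ≤ F s - F (1 / 4)) :
    ∃ (M : ℕ → ℕ) (ν σ : ℕ → ℕ → ℝ), (∀ n i, 0 ≤ ν n i) ∧ (∀ n i, 0 < σ n i) ∧
      (∀ n, ∑ i ∈ Finset.range (M n), ν n i ≤ 1) ∧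
      (∀ n, η ≤ ∑ i ∈ Finset.range (M n), (if 1 / 4 ≤ σ n i then ν n i else 0)) ∧
      (∀ s, 0 ≤ s → Tendsto (fun n => superE (Finset.range (M n)) (ν n) (σ n) p s) atTop
        (nhds (potential p F s))) ∧
      Tendsto (fun n => superC (Finset.range (M n)) (ν n) (σ n) p) atTop
        (nhds (potentialSlope p F)) := by
  choose M ν σ hν hσ hν1 hνη hb happ using exists_tent_approximation hc hF h0 hpos hlow hη
  have hlim : ∀ s, 0 ≤ s → Tendsto
      (fun n => ∑ i ∈ Finset.range (M n), ν n i * min s (σ n i)) atTop (nhds (1 - F s)) := by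
    intro s hs
    rw [tendsto_iff_norm_sub_tendsto_zero]
    have h1 : Tendsto (fun n : ℕ => 1 / 4 * (1 / ((n : ℝ) + 1))) atTop (nhds 0) := by
      simpa using tendsto_one_div_add_atTop_nhds_zero_nat.const_mul (1 / 4 : ℝ)
    refine squeeze_zero' (Eventually.of_forall fun _ => norm_nonneg _) ?_ h1
    obtain ⟨N, hN⟩ := exists_nat_gt (4 * s)
    filter_upwards [eventually_ge_atTop N] with n hn
    have hn' : (N : ℝ) ≤ n := by exact_mod_cast hn
    refine (happ n s hs (by linarith)).trans (le_of_eq ?_)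
    field_simp
  have hcont : ∀ n, Continuous fun ξ : ℝ =>
      ∑ i ∈ Finset.range (M n), ν n i * min (ξ ^ 2) (σ n i) := by
    intro n
    fun_prop
  refine ⟨M, ν, σ, hν, hσ, hν1, hνη, fun s hs => ?_, ?_⟩
  · rcases hs.eq_or_lt with rfl | hs
    · simp [superE, tentE, potential]
    · simp only [← integral_super_mul_ker hp hp1 (hσ _) hs, potential, if_neg hs.ne']
      have hk := integrableOn_ker hp hp1 (Real.sqrt_pos.mpr hs)
      refine tendsto_setIntegral_mul_of_bounded (b := fun _ => 1) hcont hk.aestronglyMeasurable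
        (by simp only [one_mul]; exact hk.abs) (fun n ξ _ => ?_) fun ξ _ => hlim _ (sq_nonneg ξ)
      exact ⟨(hb n _ (sq_nonneg ξ)).1, (hb n _ (sq_nonneg ξ)).2.trans (min_le_right _ _)⟩
  · simp only [← integral_super_mul_rpow hp hp1 (hσ _), potentialSlope]
    refine Tendsto.const_mul _ ?_
    have hi := (integrableOn_min_mul_rpow hp hp1 one_pos).1
    refine tendsto_setIntegral_mul_of_bounded (b := fun ξ => min (ξ ^ 2) 1) hcont
      ((measurable_id.pow_const _).aestronglyMeasurable) ?_
      (fun n ξ _ => hb n _ (sq_nonneg ξ)) fun ξ _ => hlim _ (sq_nonneg ξ)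
    refine hi.congr_fun (fun ξ hξ => ?_) measurableSet_Ioi
    simp only [one_pow, abs_of_nonneg (Real.rpow_nonneg (le_of_lt hξ) _)]

/-- The shape properties of the potential which are inherited from superpositions of tents. -/
lemma potential_properties (hp : -1 < p) (hp1 : p < 1)
    (hc : ConvexOn ℝ (Ici 0) F) (hF : AntitoneOn F (Ici 0))
    (h0 : F 0 = 1) (hpos : ∀ s, 0 ≤ s → 0 ≤ F s) (hlow : ∀ s, 0 ≤ s → 1 - s ≤ F s)
    (hη : ∀ s, 0 ≤ s → s < 1 / 4 → η * (1 / 4 - s) ≤ F s - F (1 / 4)) (hη0 : 0 < η)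
    (hηp : (1 - (p + 1) / 5) * η ^ ((p + 1) / (4 - p)) + η ≤ tentV p 1 / tentA p) :
    ConcaveOn ℝ (Ici 0) (potential p F) ∧ MonotoneOn (potential p F) (Ici 0) ∧
      (∀ s, 0 ≤ s → potential p F s ≤ potentialSlope p F * s) ∧
      (∀ s, 0 ≤ s → s ≤ 1 / 4 →
        η * potentialSlope p F * (1 / 4 - s) ≤ potential p F (1 / 4) - potential p F s) ∧
      0 < potentialSlope p F := by
  obtain ⟨M, ν, σ, hν, hσ, hν1, hνη, hE, hC⟩ :=
    exists_super_approximation hp hp1 hc hF h0 hpos hlow hη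
  refine ⟨⟨convex_Ici 0, fun x hx y hy a b ha hb hab => ?_⟩, fun x hx y hy hxy => ?_,
    fun s hs => ?_, fun s hs hs4 => ?_, ?_⟩
  · exact le_of_tendsto_of_tendsto' (((hE x hx).const_smul a).add ((hE y hy).const_smul b))
      (hE _ ((convex_Ici 0) hx hy ha hb hab))
      fun n => (superE_concaveOn hp hp1 (hν n) (hσ n)).2 hx hy ha hb hab
  · exact le_of_tendsto_of_tendsto' (hE x hx) (hE y hy)
      fun n => superE_monotoneOn hp hp1 (hν n) (hσ n) hx hy hxy
  · exact le_of_tendsto_of_tendsto' (hE s hs) (hC.mul_const s)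
      fun n => superE_le hp hp1 (hν n) (hσ n) hs
  · exact le_of_tendsto_of_tendsto' ((hC.const_mul η).mul_const _)
      ((hE _ (by norm_num)).sub (hE s hs))
      fun n => superE_slope hp hp1 (hν n) (hσ n) hη0 hηp (hν1 n) (hνη n) hs hs4
  · refine lt_of_lt_of_le (b := tentA p * (η * (1 / 2) ^ (p + 1))) ?_
      (ge_of_tendsto' hC fun n => superC_lower hp hp1 (hν n) (hνη n))
    have := tentA_pos hp hp1
    positivity

end Limit

section Link

variable {α : ℝ} {f : ℝ → ℝ}

lemma C1_pos (h0 : 0 < α) (h1 : α < 1) : 0 < C1 α := by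
  have h2 := Real.Gamma_pos_of_pos (show 0 < 1 / 2 + α by linarith)
  have h3 := Real.Gamma_pos_of_pos (show 0 < 1 - α by linarith)
  unfold C1
  positivity

lemma cV_eq (h1 : α < 1) :
    cV α f = C1 α * potentialSlope (1 - 2 * α) (fun s => f √s) := by
  have h : ∫ ξ in Ioi (0:ℝ), (1 - f ξ) * ξ ^ (-1 - 2 * α)
      = ∫ ξ in Ioi (0:ℝ), (1 - f √(ξ ^ 2)) * ξ ^ (1 - 2 * α - 2) := by
    refine setIntegral_congr_fun measurableSet_Ioi fun ξ hξ => ?_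
    simp only [Real.sqrt_sq (le_of_lt hξ)]
    ring_nf
  have e : 1 - 2 * α + 1 ≠ 0 := by linarith
  rw [cV, h, potentialSlope, tentA]
  field_simp
  ring

lemma integral_mul_ker_eq (h0 : 0 < α) (h1 : α < 1) (hf : Continuous f)
    (hb : ∀ x, 0 < x → |f x| ≤ 1) {x : ℝ} (hx : x ≠ 0) :
    potential (1 - 2 * α) (fun s => f √s) (x ^ 2)
      = -∫ ξ in Ioi (0:ℝ), f ξ * ker (1 - 2 * α) |x| ξ := by
  have hp : -1 < 1 - 2 * α := by linarith
  have hp1 : 1 - 2 * α < 1 := by linarith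
  have hk := integrableOn_ker hp hp1 (abs_pos.mpr hx)
  have hfk : IntegrableOn (fun ξ => f ξ * ker (1 - 2 * α) |x| ξ) (Ioi 0) := by
    refine hk.bdd_mul (c := 1) hf.aestronglyMeasurable ?_
    filter_upwards [ae_restrict_mem measurableSet_Ioi] with ξ hξ using hb ξ hξ
  have h := integral_sub hk hfk
  rw [integral_ker hp hp1 (abs_pos.mpr hx), zero_sub] at h
  rw [potential, if_neg (by positivity), Real.sqrt_sq_eq_abs, ← h]
  refine setIntegral_congr_fun measurableSet_Ioi fun ξ hξ => ?_
  simp only [Real.sqrt_sq (le_of_lt hξ)]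
  ring

lemma TV_eq (h0 : 0 < α) (h1 : α < 1) (hf : Continuous f)
    (hb : ∀ x, 0 < x → |f x| ≤ 1) (x : ℝ) :
    TV α f x = -(C1 α * potential (1 - 2 * α) (fun s => f √s) (x ^ 2)) := by
  unfold TV
  split_ifs with hx ha
  · simp [hx, potential]
  · rw [integral_mul_ker_eq h0 h1 hf hb hx, mul_neg, neg_neg]
    congr 1
    refine integral_congr_ae ?_
    filter_upwards [ae_restrict_mem measurableSet_Ioi,
      ae_restrict_of_ae (Measure.ae_ne volume |x|)] with ξ hξ hne
    have h2 : |x| + ξ ≠ 0 := (add_pos_of_nonneg_of_pos (abs_nonneg x) hξ).ne'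
    have h3 : |x| - ξ ≠ 0 := sub_ne_zero.mpr (Ne.symm hne)
    have h4 : 1 - 2 * α = 0 := by rw [ha]; norm_num
    rw [Real.log_div h2 (abs_ne_zero.mpr h3), Real.log_abs, h4]
    simp [ker, psi]
  · have hp : 1 - 2 * α ≠ 0 := fun h => ha (by linarith)
    rw [integral_mul_ker_eq h0 h1 hf hb hx, mul_neg, neg_neg, div_mul_eq_mul_div, mul_div_assoc]
    congr 1
    rw [div_eq_iff hp, ← integral_mul_const]
    refine setIntegral_congr_fun measurableSet_Ioi fun ξ hξ => ?_
    have h2 : 0 < |x| + ξ := add_pos_of_nonneg_of_pos (abs_nonneg x) hξ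
    have h3 := mul_psi (1 - 2 * α) (|x| + ξ)
    have h4 := mul_psi (1 - 2 * α) (|x| - ξ)
    rw [abs_of_pos h2] at h3
    simp only [ker]
    linear_combination (-(f ξ * (ξ / |x|))) * (h3 - h4)

end Link

section Assembly

variable {α : ℝ} {f G : ℝ → ℝ}

/-- A function of `x²` with the right profile belongs to `V1`. -/
lemma V1_comp_sq (h0 : 0 < α) (hG : ConvexOn ℝ (Ici 0) G) (hanti : AntitoneOn G (Ici 0))
    (hG0 : G 0 = 1) (hlow : ∀ s, 0 ≤ s → max 0 (1 - s) ≤ G s)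
    (hη : ∀ s, 0 ≤ s → s < 1 / 4 → etaC α * (1 / 4 - s) ≤ G s - G (1 / 4)) :
    V1 α fun x => G (x ^ 2) := by
  have hle : ∀ s, 0 ≤ s → G s ≤ 1 := fun s hs =>
    hG0 ▸ hanti (mem_Ici.mpr le_rfl) (mem_Ici.mpr hs) hs
  have hnn : ∀ s, 0 ≤ s → 0 ≤ G s := fun s hs => (le_max_left _ _).trans (hlow s hs)
  have hcont : ContinuousOn G (Ici 0) := by
    refine hG.continuousOn_Ici ?_
    have h1 : Tendsto (fun s : ℝ => 1 - s) (nhdsWithin 0 (Ici 0)) (nhds 1) := by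
      have : Continuous fun s : ℝ => 1 - s := by fun_prop
      simpa using (this.tendsto 0).mono_left nhdsWithin_le_nhds
    rw [ContinuousWithinAt, hG0]
    refine tendsto_of_tendsto_of_tendsto_of_le_of_le' h1 tendsto_const_nhds ?_ ?_
    · filter_upwards [self_mem_nhdsWithin] with s hs using (le_max_right _ _).trans (hlow s hs)
    · filter_upwards [self_mem_nhdsWithin] with s hs using hle s hs
  refine ⟨?_, fun x => by simp, ⟨1, fun x => ?_⟩, by simpa using hG0,
    fun x _ => hnn _ (sq_nonneg x), fun x hx y hy hxy => ?_, ?_,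
    fun x => hlow _ (sq_nonneg x), ?_⟩
  · exact hcont.comp_continuous (continuous_pow 2) fun x => sq_nonneg x
  · rw [abs_of_nonneg (hnn _ (sq_nonneg x))]
    refine mul_le_one₀ ?_ (hnn _ (sq_nonneg x)) (hle _ (sq_nonneg x))
    exact Real.rpow_le_one_of_one_le_of_nonpos (by linarith [abs_nonneg x]) (by linarith)
  · exact hanti (sq_nonneg x) (sq_nonneg y) (pow_le_pow_left₀ hx hxy 2)
  · refine hG.congr fun x hx => ?_
    simp only [Real.sq_sqrt hx]
  · have hi : (1 / 4 : ℝ) ∈ interior (Ici (0:ℝ)) := by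
      rw [interior_Ici]; exact mem_Ioi.mpr (by norm_num)
    have hd := hG.hasDerivWithinAt_leftDeriv_of_mem_interior hi
    set d := derivWithin G (Iio (1 / 4)) (1 / 4)
    have hsq : HasDerivWithinAt (fun x : ℝ => x ^ 2) 1 (Ioo 0 (1 / 2)) (1 / 2) :=
      ((hasDerivAt_pow 2 (1 / 2 : ℝ)).congr_deriv (by norm_num)).hasDerivWithinAt
    have hmaps : MapsTo (fun x : ℝ => x ^ 2) (Ioo 0 (1 / 2)) (Iio (1 / 4)) := fun x hx =>
      mem_Iio.mpr (by nlinarith [hx.1, hx.2])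
    have hcomp : HasDerivWithinAt (G ∘ fun x : ℝ => x ^ 2) (d * 1) (Ioo 0 (1 / 2)) (1 / 2) :=
      HasDerivWithinAt.comp_of_eq (1 / 2) hd hsq hmaps (by norm_num)
    rw [mul_one] at hcomp
    refine ⟨d, hcomp.mono_of_mem_nhdsWithin (Ioo_mem_nhdsLT (by norm_num)), ?_⟩
    refine le_of_tendsto ((hasDerivWithinAt_iff_tendsto_slope' self_notMem_Iio).mp hd) ?_
    filter_upwards [Ioo_mem_nhdsLT (show (0:ℝ) < 1 / 4 by norm_num)] with s hs
    have hpos : 0 < 1 / 4 - s := sub_pos.mpr hs.2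
    rw [slope_comm, slope_def_field, div_le_iff₀ hpos]
    linarith [hη s hs.1.le hs.2]

/-- The slope condition at `1/2`, as a secant bound in the variable `s = x²`. -/
lemma V1.slope_sqrt (hf : V1 α f) {s : ℝ} (hs : 0 ≤ s) (hs4 : s < 1 / 4) :
    etaC α * (1 / 4 - s) ≤ f √s - f √(1 / 4) := by
  obtain ⟨-, -, -, -, -, -, hc, -, d, hd, hdη⟩ := hf
  have e : √(1 / 4 : ℝ) = 1 / 2 := by
    rw [show (1 / 4 : ℝ) = (1 / 2) ^ 2 by norm_num, Real.sqrt_sq (by norm_num)]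
  have hsq : HasDerivWithinAt (fun x : ℝ => √x) 1 (Iio (1 / 4)) (1 / 4) := by
    have := (Real.hasDerivAt_sqrt (x := 1 / 4) (by norm_num)).hasDerivWithinAt (s := Iio (1 / 4))
    rw [e] at this
    simpa using this
  have hcomp := hd.comp_of_eq (x := (1 / 4 : ℝ)) hsq (fun x hx => by
    rw [mem_Iio, Real.sqrt_lt' (by norm_num)]
    exact lt_of_lt_of_eq hx (by norm_num)) e.symm
  rw [mul_one] at hcomp
  have h := hc.slope_le_of_hasDerivWithinAt_Iio (mem_Ici.mpr hs)
    (mem_Ici.mpr (by norm_num)) hs4 hcomp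
  have hpos : 0 < 1 / 4 - s := sub_pos.mpr hs4
  rw [slope_def_field, div_le_iff₀ hpos] at h
  nlinarith [mul_le_mul_of_nonneg_right hdη hpos.le]

end Assembly

/-- For every `α ∈ (0,1)`, the operator `ℛ_α` maps `𝒱₁` into itself. -/
theorem RV_mapsTo_V1 (α : ℝ) (hα : α ∈ Ioo (0:ℝ) 1) (f : ℝ → ℝ) (hf : V1 α f) :
    V1 α (RV α f) := by
  obtain ⟨h0, h1⟩ := hα
  obtain ⟨hcont, -, -, hf0, hnn, hanti, hc, hlow, -⟩ := id hf
  have hle : ∀ x, 0 ≤ x → f x ≤ 1 := fun x hx =>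
    hf0 ▸ hanti (mem_Ici.mpr le_rfl) (mem_Ici.mpr hx) hx
  have hb : ∀ x, 0 < x → |f x| ≤ 1 := fun x hx => by
    rw [abs_of_nonneg (hnn x hx.le)]
    exact hle x hx.le
  obtain ⟨hconc, hmono, hup, hslope, hpos⟩ := potential_properties
    (p := 1 - 2 * α) (η := etaC α) (F := fun s => f √s) (by linarith) (by linarith) hc
    (fun s _ t _ hst => hanti (Real.sqrt_nonneg s) (Real.sqrt_nonneg t) (Real.sqrt_le_sqrt hst))
    (by simpa using hf0) (fun s _ => hnn _ (Real.sqrt_nonneg s))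
    (fun s hs => by
      have := (le_max_right _ _).trans (hlow √s)
      rwa [Real.sq_sqrt hs] at this)
    (fun s hs hs4 => hf.slope_sqrt hs hs4) (etaC_pos h0 h1) (etaC_slope_condition h0 h1 rfl)
  set P := potential (1 - 2 * α) (fun s => f √s) with hP
  set c := potentialSlope (1 - 2 * α) (fun s => f √s) with hcdef
  have hRV : RV α f = fun x => max 0 (1 - P (x ^ 2) / c) := by
    funext x
    have := (C1_pos h0 h1).ne'
    rw [RV, TV_eq h0 h1 hcont hb, cV_eq h1, ← hP, ← hcdef, neg_div, mul_div_mul_left _ _ this,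
      ← sub_eq_add_neg]
  have hlow' : ∀ s, 0 ≤ s → 1 - s ≤ 1 - P s / c := fun s hs => by
    have : P s / c ≤ s := (div_le_iff₀ hpos).mpr (by linarith [hup s hs])
    linarith
  rw [hRV]
  refine V1_comp_sq (G := fun s => max 0 (1 - P s / c)) h0 ?_ ?_ ?_ ?_ ?_
  · refine (convexOn_const 0 (convex_Ici 0)).sup ?_
    refine ((convexOn_const 1 (convex_Ici 0)).sub (hconc.smul (inv_pos.mpr hpos).le)).congr
      fun s _ => ?_
    simp [div_eq_inv_mul]
  · intro s hs t ht hst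
    have := div_le_div_of_nonneg_right (hmono hs ht hst) hpos.le
    exact max_le_max le_rfl (by linarith)
  · simp [hP, potential]
  · exact fun s hs => max_le_max le_rfl (hlow' s hs)
  · intro s hs hs4
    have h4 := hlow' (1 / 4) (by norm_num)
    have h5 : etaC α * (1 / 4 - s) ≤ (P (1 / 4) - P s) / c :=
      (le_div_iff₀ hpos).mpr (by linarith [hslope s hs hs4.le])
    rw [sub_div] at h5
    have h6 := le_max_right 0 (1 - P s / c)
    rw [max_eq_right (a := (0:ℝ)) (b := 1 - P (1 / 4) / c) (by linarith)]
    linarith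

end GSQGplane
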